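/- For every integer j ≥ 1, the limit lim_{ε→0⁺} ε^{2α} ( λ_j(ε) − π²/(M² ε²) ) exists and equals μ_j. -/

import Mathlib

open MeasureTheory Real Filter Set

/-- `|∇ψ|² = (∂ₓψ)² + (∂_yψ)²` for a function `ψ : ℝ² → ℝ`. -/
noncomputable def gradSq (ψ : ℝ × ℝ → ℝ) (p : ℝ × ℝ) : ℝ :=
  (deriv (fun s => ψ (s, p.2)) p.1) ^ 2 + (deriv (fun t => ψ (p.1, t)) p.2) ^ 2

/-- The `j`-th Courant–Fischer min–max value of the Dirichlet Laplacian on an open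
set `Ω ⊆ ℝ²`: the infimum over `j`-dimensional subspaces `F` of `C_c^∞(Ω)` of the
supremum of the Rayleigh quotient over nonzero `ψ ∈ F`. -/
noncomputable def dirichletMinMax (Ω : Set (ℝ × ℝ)) (j : ℕ) : ℝ :=
  sInf { r : ℝ | ∃ F : Submodule ℝ ((ℝ × ℝ) → ℝ),
    Module.finrank ℝ F = j ∧
    (∀ ψ ∈ F, ContDiff ℝ (⊤ : ℕ∞) ψ ∧ HasCompactSupport ψ ∧ tsupport ψ ⊆ Ω) ∧
    r = sSup { s : ℝ | ∃ ψ ∈ F, ψ ≠ (0 : (ℝ × ℝ) → ℝ) ∧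
      s = (∫ p in Ω, gradSq ψ p) / (∫ p in Ω, (ψ p) ^ 2) } }

/-- The `j`-th min–max value of the Schrödinger operator `−d²/dx² + q` on `L²(ℝ)`. -/
noncomputable def schroedingerMinMax (q : ℝ → ℝ) (j : ℕ) : ℝ :=
  sInf { r : ℝ | ∃ F : Submodule ℝ (ℝ → ℝ),
    Module.finrank ℝ F = j ∧
    (∀ χ ∈ F, ContDiff ℝ (⊤ : ℕ∞) χ ∧ HasCompactSupport χ) ∧
    r = sSup { s : ℝ | ∃ χ ∈ F, χ ≠ (0 : ℝ → ℝ) ∧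
      s = (∫ x : ℝ, (deriv χ x ^ 2 + q x * χ x ^ 2)) / (∫ x : ℝ, χ x ^ 2) } }

lemma ns_wirt_aux (G : ℝ → ℝ) (hG : ContDiff ℝ 1 G) (u v k : ℝ) (huv : u < v)
    (hu : G u = 0) (hv : G v = 0) (hk : 0 < k) (hk2 : k * (v - u) < π) :
    k ^ 2 * ∫ y in u..v, G y ^ 2 ≤ ∫ y in u..v, deriv G y ^ 2 := by
  have hGc : Continuous G := hG.continuous
  have hGd : Continuous (deriv G) := hG.continuous_deriv le_rfl
  have hGD : ∀ y, HasDerivAt G (deriv G y) y := fun y =>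
    (hG.differentiable one_ne_zero y).hasDerivAt
  set c := (u + v) / 2 with hc
  have hcos : ∀ y ∈ Icc u v, 0 < cos (k * (y - c)) := by
    intro y hy
    apply cos_pos_of_mem_Ioo
    constructor <;> nlinarith [hy.1, hy.2, mul_le_mul_of_nonneg_left hy.1 hk.le, mul_le_mul_of_nonneg_left hy.2 hk.le]
  set w : ℝ → ℝ := fun y => -k * (sin (k * (y - c)) / cos (k * (y - c))) with hw
  have hwc : ContinuousOn w (Icc u v) := by
    apply ContinuousOn.mul continuousOn_const
    apply ContinuousOn.div (by fun_prop) (by fun_prop)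
    intro y hy; exact (hcos y hy).ne'
  have hwd : ∀ y ∈ Icc u v, HasDerivAt w (-k ^ 2 - w y ^ 2) y := by
    intro y hy
    have h0 := (hcos y hy).ne'
    have h1 : HasDerivAt (fun y => k * (y - c)) k y := by
      simpa using ((hasDerivAt_id y).sub_const c).const_mul k
    have h2 := ((h1.sin.div h1.cos h0).const_mul (-k))
    refine h2.congr_deriv ?_
    show _ = -k ^ 2 - (-k * (sin (k * (y - c)) / cos (k * (y - c)))) ^ 2
    field_simp
    ring
  have hF : ∀ y ∈ uIcc u v, HasDerivAt (fun y => w y * G y ^ 2)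
      ((-k ^ 2 - w y ^ 2) * G y ^ 2 + w y * (2 * G y * deriv G y)) y := by
    intro y hy
    rw [uIcc_of_le huv.le] at hy
    have := (hwd y hy).mul ((hGD y).pow 2)
    refine this.congr_deriv ?_
    simp
  have hcont : ContinuousOn (fun y => (-k ^ 2 - w y ^ 2) * G y ^ 2 + w y * (2 * G y * deriv G y)) (uIcc u v) := by
    rw [uIcc_of_le huv.le]
    fun_prop
  have hint := intervalIntegral.integral_eq_sub_of_hasDerivAt hF hcont.intervalIntegrable
  simp only [hu, hv] at hint
  have hsq : 0 ≤ ∫ y in u..v, (deriv G y - w y * G y) ^ 2 :=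
    intervalIntegral.integral_nonneg huv.le (fun _ _ => sq_nonneg _)
  have hi1 : IntervalIntegrable (fun y => deriv G y ^ 2) volume u v := (hGd.pow 2).intervalIntegrable _ _
  have hi2 : IntervalIntegrable (fun y => k ^ 2 * G y ^ 2) volume u v :=
    (continuous_const.mul (hGc.pow 2)).intervalIntegrable _ _
  have key : ∫ y in u..v, (deriv G y - w y * G y) ^ 2 =
      (∫ y in u..v, deriv G y ^ 2) - (∫ y in u..v, k ^ 2 * G y ^ 2) -
      ∫ y in u..v, ((-k ^ 2 - w y ^ 2) * G y ^ 2 + w y * (2 * G y * deriv G y)) := by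
    rw [← intervalIntegral.integral_sub hi1 hi2, ← intervalIntegral.integral_sub (hi1.sub hi2) hcont.intervalIntegrable]
    congr 1; ext y; ring
  rw [hint, intervalIntegral.integral_const_mul] at key
  linarith

lemma ns_wirt (G : ℝ → ℝ) (hG : ContDiff ℝ 1 G) (u v : ℝ) (huv : u < v)
    (hu : G u = 0) (hv : G v = 0) :
    (π / (v - u)) ^ 2 * ∫ y in u..v, G y ^ 2 ≤ ∫ y in u..v, deriv G y ^ 2 := by
  have hvu : 0 < v - u := sub_pos.2 huv
  have ht : Tendsto (fun k : ℝ => k ^ 2 * ∫ y in u..v, G y ^ 2) (nhdsWithin (π / (v - u)) (Iio (π / (v - u))))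
      (nhds ((π / (v - u)) ^ 2 * ∫ y in u..v, G y ^ 2)) := by
    apply Tendsto.mono_left _ nhdsWithin_le_nhds
    exact Continuous.tendsto (by fun_prop) _
  refine le_of_tendsto ht ?_
  have h0 : 0 < π / (v - u) := by positivity
  filter_upwards [self_mem_nhdsWithin, mem_nhdsWithin_of_mem_nhds (Ioi_mem_nhds h0)] with k hk hk0
  exact ns_wirt_aux G hG u v k huv hu hv hk0 ((lt_div_iff₀ hvu).1 hk)

lemma ns_sin_sq (L : ℝ) (hL : 0 < L) : ∫ y in (0:ℝ)..L, sin (π / L * y) ^ 2 = L / 2 := by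
  have hp : π / L ≠ 0 := by positivity
  rw [intervalIntegral.integral_comp_mul_left (fun y => sin y ^ 2) hp]
  simp only [integral_sin_sq]
  have : π / L * L = π := by field_simp
  rw [this]; simp; field_simp

lemma ns_cs (g : ℝ → ℝ) (hg : Continuous g) (L c : ℝ) (hL : 0 < L) :
    (∫ y in (0:ℝ)..L, g y ^ 2) - (2 / L) * (∫ y in (0:ℝ)..L, g y * sin (π / L * y)) ^ 2 ≤
      ∫ y in (0:ℝ)..L, (g y - c * sin (π / L * y)) ^ 2 := by
  have e : ∫ y in (0:ℝ)..L, (g y - c * sin (π / L * y)) ^ 2 =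
     (∫ y in (0:ℝ)..L, g y ^ 2) - (∫ y in (0:ℝ)..L, 2 * c * (g y * sin (π / L * y))) +
      ∫ y in (0:ℝ)..L, c ^ 2 * sin (π / L * y) ^ 2 := by
    rw [← intervalIntegral.integral_sub (Continuous.intervalIntegrable (by fun_prop) _ _) (Continuous.intervalIntegrable (by fun_prop) _ _),
      ← intervalIntegral.integral_add (Continuous.intervalIntegrable (by fun_prop) _ _) (Continuous.intervalIntegrable (by fun_prop) _ _)]
    congr 1; ext y; ring
  rw [e, intervalIntegral.integral_const_mul, intervalIntegral.integral_const_mul, ns_sin_sq L hL]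
  set I := ∫ y in (0:ℝ)..L, g y * sin (π / L * y)
  have : 0 ≤ (2 / L) * (I - c * (L / 2)) ^ 2 := by positivity
  have e2 : (2 / L) * (I - c * (L / 2)) ^ 2 = (2 / L) * I ^ 2 - 2 * c * I + c ^ 2 * (L / 2) := by
    field_simp; ring
  linarith

lemma ns_cs0 (g : ℝ → ℝ) (hg : Continuous g) (L : ℝ) (hL : 0 < L) :
    (2 / L) * (∫ y in (0:ℝ)..L, g y * sin (π / L * y)) ^ 2 ≤ (∫ y in (0:ℝ)..L, g y ^ 2) := by
  set I := ∫ y in (0:ℝ)..L, g y * sin (π / L * y) with hI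
  have e : ∫ y in (0:ℝ)..L, (g y - (2 / L * I) * sin (π / L * y)) ^ 2 =
     (∫ y in (0:ℝ)..L, g y ^ 2) - (∫ y in (0:ℝ)..L, 2 * (2 / L * I) * (g y * sin (π / L * y))) +
      ∫ y in (0:ℝ)..L, (2 / L * I) ^ 2 * sin (π / L * y) ^ 2 := by
    rw [← intervalIntegral.integral_sub (Continuous.intervalIntegrable (by fun_prop) _ _) (Continuous.intervalIntegrable (by fun_prop) _ _),
      ← intervalIntegral.integral_add (Continuous.intervalIntegrable (by fun_prop) _ _) (Continuous.intervalIntegrable (by fun_prop) _ _)]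
    congr 1; ext y; ring
  rw [intervalIntegral.integral_const_mul, intervalIntegral.integral_const_mul, ns_sin_sq L hL, ← hI] at e
  have h0 : 0 ≤ ∫ y in (0:ℝ)..L, (g y - (2 / L * I) * sin (π / L * y)) ^ 2 :=
    intervalIntegral.integral_nonneg hL.le (fun _ _ => sq_nonneg _)
  have e2 : 2 * (2 / L * I) * I - (2 / L * I) ^ 2 * (L / 2) = 2 / L * I ^ 2 := by field_simp; ring
  linarith

lemma ns_gap (g : ℝ → ℝ) (hg : ContDiff ℝ 1 g) (L : ℝ) (hL : 0 < L)
    (h0 : g 0 = 0) (h1 : g L = 0) :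
    3 * (π / L) ^ 2 * ((∫ y in (0:ℝ)..L, g y ^ 2) - (2 / L) * (∫ y in (0:ℝ)..L, g y * sin (π / L * y)) ^ 2)
      ≤ (∫ y in (0:ℝ)..L, deriv g y ^ 2) - (π / L) ^ 2 * ∫ y in (0:ℝ)..L, g y ^ 2 := by
  have hgc : Continuous g := hg.continuous
  have hgd : Continuous (deriv g) := hg.continuous_deriv le_rfl
  have hgD : ∀ y, HasDerivAt g (deriv g y) y := fun y =>
    (hg.differentiable one_ne_zero y).hasDerivAt
  set κ := π / L with hκ
  have hκL : κ * L = π := by rw [hκ]; field_simp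
  set c := g (L / 2) with hc
  set G : ℝ → ℝ := fun y => g y - c * sin (κ * y) with hGdef
  have hs : ∀ y, HasDerivAt (fun y => sin (κ * y)) (cos (κ * y) * κ) y := fun y => by
    simpa using ((hasDerivAt_id y).const_mul κ).sin
  have hco : ∀ y, HasDerivAt (fun y => cos (κ * y)) (- sin (κ * y) * κ) y := fun y => by
    simpa using ((hasDerivAt_id y).const_mul κ).cos
  have hGD : ∀ y, HasDerivAt G (deriv g y - c * (cos (κ * y) * κ)) y := fun y =>
    (hgD y).sub ((hs y).const_mul c)
  have hG : ContDiff ℝ 1 G := by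
    apply hg.sub; fun_prop
  have dG : deriv G = fun y => deriv g y - c * (cos (κ * y) * κ) := funext fun y => (hGD y).deriv
  have G0 : G 0 = 0 := by simp [hGdef, h0]
  have G1 : G L = 0 := by simp [hGdef, h1, hκL]
  have Gm : G (L / 2) = 0 := by
    have : κ * (L / 2) = π / 2 := by linarith
    simp [hGdef, this, hc]
  have w1 := ns_wirt G hG 0 (L / 2) (by positivity) G0 Gm
  have w2 := ns_wirt G hG (L / 2) L (by linarith) Gm G1
  have k1 : π / (L / 2 - 0) = 2 * κ := by rw [hκ, sub_zero]; field_simp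
  have k2 : π / (L - L / 2) = 2 * κ := by
    rw [show L - L / 2 = L / 2 by ring, hκ]; field_simp
  rw [k1] at w1
  rw [k2] at w2
  have cG : Continuous G := hG.continuous
  have cdG : Continuous (deriv G) := hG.continuous_deriv le_rfl
  have a1 := intervalIntegral.integral_add_adjacent_intervals (μ := volume) (f := fun y => G y ^ 2) (a := 0) (b := L / 2) (c := L)
    ((cG.pow 2).intervalIntegrable _ _) ((cG.pow 2).intervalIntegrable _ _)
  have a2 := intervalIntegral.integral_add_adjacent_intervals (μ := volume) (f := fun y => deriv G y ^ 2) (a := 0) (b := L / 2) (c := L)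
    ((cdG.pow 2).intervalIntegrable _ _) ((cdG.pow 2).intervalIntegrable _ _)
  have hB : ∀ y ∈ uIcc 0 L, HasDerivAt (fun y => -2 * c * κ * (g y * cos (κ * y)) + c ^ 2 * κ * (sin (κ * y) * cos (κ * y)))
      (-2 * c * κ * (deriv g y * cos (κ * y) + g y * (- sin (κ * y) * κ)) +
        c ^ 2 * κ * ((cos (κ * y) * κ) * cos (κ * y) + sin (κ * y) * (- sin (κ * y) * κ))) y := fun y _ =>
    (((hgD y).mul (hco y)).const_mul _).add (((hs y).mul (hco y)).const_mul _)
  have hint := intervalIntegral.integral_eq_sub_of_hasDerivAt hB (Continuous.intervalIntegrable (by fun_prop) _ _)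
  simp only [h0, h1, hκL, sin_pi, mul_zero, sin_zero, zero_mul, add_zero, sub_zero] at hint
  have key : (∫ y in (0:ℝ)..L, deriv G y ^ 2) - (∫ y in (0:ℝ)..L, κ ^ 2 * G y ^ 2) =
     (∫ y in (0:ℝ)..L, deriv g y ^ 2) - (∫ y in (0:ℝ)..L, κ ^ 2 * g y ^ 2) := by
    rw [← sub_eq_zero, ← hint,
      ← intervalIntegral.integral_sub (Continuous.intervalIntegrable (by fun_prop) _ _) (Continuous.intervalIntegrable (by fun_prop) _ _),
      ← intervalIntegral.integral_sub (Continuous.intervalIntegrable (by fun_prop) _ _) (Continuous.intervalIntegrable (by fun_prop) _ _),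
      ← intervalIntegral.integral_sub (Continuous.intervalIntegrable (by fun_prop) _ _) (Continuous.intervalIntegrable (by fun_prop) _ _)]
    congr 1; ext y; rw [dG]; simp only [hGdef]; ring
  rw [intervalIntegral.integral_const_mul, intervalIntegral.integral_const_mul] at key
  have cs := ns_cs g hgc L c hL
  rw [← hκ] at cs
  have hk0 : 0 ≤ 3 * κ ^ 2 := by positivity
  have := mul_le_mul_of_nonneg_left cs hk0
  simp only [hGdef] at a1 a2 w1 w2 key
  nlinarith

lemma ns_quad_bdd {V : Type*} [AddCommGroup V] [Module ℝ V] [FiniteDimensional ℝ V]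
    (A B : V →ₗ[ℝ] V →ₗ[ℝ] ℝ) (hB : ∀ v, v ≠ 0 → 0 < B v v) :
    ∃ C, ∀ v, A v v ≤ C * B v v := by
  let e := (Module.finBasis ℝ V).equivFun
  have hcont : ∀ A : V →ₗ[ℝ] V →ₗ[ℝ] ℝ, Continuous (fun c => A (e.symm c) (e.symm c)) := by
    intro A
    let A' := A.compl₁₂ e.symm.toLinearMap e.symm.toLinearMap
    let L := (LinearMap.toContinuousLinearMap :
      ((Fin (Module.finrank ℝ V) → ℝ) →ₗ[ℝ] ℝ) ≃ₗ[ℝ] _).toLinearMap ∘ₗ A'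
    have hL : Continuous L := L.continuous_of_finiteDimensional
    exact hL.clm_apply continuous_id
  have hK : IsCompact (Metric.sphere (0 : Fin (Module.finrank ℝ V) → ℝ) 1) := isCompact_sphere _ _
  have hne : ∀ c ∈ Metric.sphere (0 : Fin (Module.finrank ℝ V) → ℝ) 1, 0 < B (e.symm c) (e.symm c) := by
    intro c hc
    apply hB
    intro h
    have : c = 0 := by simpa using h
    simp [this] at hc
  have hco : ContinuousOn (fun c => A (e.symm c) (e.symm c) / B (e.symm c) (e.symm c))
      (Metric.sphere (0 : Fin (Module.finrank ℝ V) → ℝ) 1) :=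
    (hcont A).continuousOn.div (hcont B).continuousOn (fun c hc => (hne c hc).ne')
  obtain ⟨C, hC⟩ := hK.bddAbove_image hco
  refine ⟨C, fun v => ?_⟩
  by_cases hv : v = 0
  · simp [hv]
  have hn : ‖e v‖ ≠ 0 := by simpa using hv
  have hs : (‖e v‖⁻¹) • e v ∈ Metric.sphere (0 : Fin (Module.finrank ℝ V) → ℝ) 1 := by
    simp [norm_smul, hn]
  have h1 := hC (mem_image_of_mem _ hs)
  simp only [map_smul, LinearEquiv.symm_apply_apply, LinearMap.smul_apply, smul_eq_mul] at h1
  have h2 := hB v hv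
  have hi : 0 < ‖e v‖⁻¹ := by positivity
  rw [div_le_iff₀ (by positivity)] at h1
  have : ‖e v‖⁻¹ * (‖e v‖⁻¹ * (A v v)) ≤ ‖e v‖⁻¹ * (‖e v‖⁻¹ * (C * B v v)) := by linarith
  exact le_of_mul_le_mul_left (le_of_mul_le_mul_left this hi) hi

lemma ns_form_bdd {X : Type*} [MeasurableSpace X] (μ : Measure X)
    {V : Type*} [AddCommGroup V] [Module ℝ V] [FiniteDimensional ℝ V]
    (D₁ D₂ D₃ : V →ₗ[ℝ] (X → ℝ))
    (h₁ : ∀ v w, Integrable (fun x => D₁ v x * D₁ w x) μ)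
    (h₂ : ∀ v w, Integrable (fun x => D₂ v x * D₂ w x) μ)
    (h₃ : ∀ v w, Integrable (fun x => D₃ v x * D₃ w x) μ)
    (hpos : ∀ v, v ≠ 0 → 0 < ∫ x, D₃ v x ^ 2 ∂μ) :
    ∃ C, ∀ v, ∫ x, (D₁ v x ^ 2 + D₂ v x ^ 2) ∂μ ≤ C * ∫ x, D₃ v x ^ 2 ∂μ := by
  have mk : ∀ D : V →ₗ[ℝ] (X → ℝ), (∀ v w, Integrable (fun x => D v x * D w x) μ) →
      ∃ A : V →ₗ[ℝ] V →ₗ[ℝ] ℝ, ∀ v, A v v = ∫ x, D v x ^ 2 ∂μ := by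
    intro D hD
    refine ⟨LinearMap.mk₂ ℝ (fun v w => ∫ x, D v x * D w x ∂μ) ?_ ?_ ?_ ?_, ?_⟩
    · intro u v w
      rw [← integral_add (hD _ _) (hD _ _)]
      congr 1; ext x; simp; ring
    · intro c u v
      rw [smul_eq_mul, ← integral_const_mul]
      congr 1; ext x; simp; ring
    · intro u v w
      rw [← integral_add (hD _ _) (hD _ _)]
      congr 1; ext x; simp; ring
    · intro c u v
      rw [smul_eq_mul, ← integral_const_mul]
      congr 1; ext x; simp; ring
    · intro v
      simp [sq]
  obtain ⟨A₁, hA₁⟩ := mk D₁ h₁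
  obtain ⟨A₂, hA₂⟩ := mk D₂ h₂
  obtain ⟨A₃, hA₃⟩ := mk D₃ h₃
  obtain ⟨C, hC⟩ := ns_quad_bdd (A₁ + A₂) A₃ (fun v hv => by rw [hA₃]; exact hpos v hv)
  refine ⟨C, fun v => ?_⟩
  have := hC v
  simp only [LinearMap.add_apply, hA₁, hA₂, hA₃] at this
  rw [integral_add (by simpa [sq] using h₁ v v) (by simpa [sq] using h₂ v v)]
  exact this

/-- positivity of the L2 norm of a nonzero continuous function -/
lemma ns_sq_pos {X : Type*} [TopologicalSpace X] [MeasurableSpace X] [BorelSpace X]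
    (μ : Measure X) [μ.IsOpenPosMeasure]
    [IsFiniteMeasureOnCompacts μ] (f : X → ℝ) (hf : Continuous f) (hs : HasCompactSupport f)
    (h0 : f ≠ 0) : 0 < ∫ x, f x ^ 2 ∂μ := by
  obtain ⟨x, hx⟩ := Function.ne_iff.1 h0
  have hs2 : HasCompactSupport (fun x => f x ^ 2) := by
    have : (fun x => f x ^ 2) = f * f := by ext; simp [sq]
    rw [this]; exact hs.mul_left
  apply Continuous.integral_pos_of_hasCompactSupport_nonneg_nonzero (x := x) (hf.pow 2) hs2
  · intro x; exact sq_nonneg _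
  · simpa using hx

/-- common compact support for finite dimensional spaces -/
lemma ns_common_supp (F : Submodule ℝ (ℝ → ℝ)) [FiniteDimensional ℝ F]
    (hF : ∀ χ ∈ F, HasCompactSupport χ) :
    ∃ R, 0 < R ∧ ∀ χ ∈ F, tsupport χ ⊆ Icc (-R) R := by
  have hfg : F.FG := (Submodule.fg_top F).1 (Module.finite_def.1 inferInstance)
  obtain ⟨s, hs⟩ := hfg
  have h1 : ∀ χ ∈ s, ∃ R : ℝ, 0 < R ∧ tsupport χ ⊆ Icc (-R) R := by
    intro χ hχ
    have hc := hF χ (hs ▸ Submodule.subset_span hχ)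
    obtain ⟨R, hR⟩ := hc.isCompact.isBounded.subset_closedBall 0
    rw [Real.closedBall_eq_Icc] at hR
    refine ⟨max R 1, by positivity, hR.trans (Icc_subset_Icc ?_ ?_)⟩
    · simp
    · simp
  choose! r hr0 hr using h1
  have hex : ∃ R : ℝ, 0 < R ∧ ∀ χ ∈ s, r χ ≤ R := by
    obtain ⟨B, hB⟩ := (s.image r).bddAbove
    refine ⟨max B 1, by positivity, fun χ hχ => le_max_of_le_left (hB ?_)⟩
    simp only [Finset.coe_image]
    exact mem_image_of_mem _ hχ
  obtain ⟨R, hR0, hR⟩ := hex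
  refine ⟨R, hR0, fun χ hχ => ?_⟩
  apply closure_minimal _ isClosed_Icc
  rw [← hs] at hχ
  induction hχ using Submodule.span_induction with
  | mem x h => exact ((subset_tsupport x).trans (hr x h)).trans (Icc_subset_Icc (by linarith [hR x h]) (hR x h))
  | zero => simp
  | add x y _ _ hx hy => exact (Function.support_add x y).trans (union_subset hx hy)
  | smul c x _ hx => exact (Function.support_const_smul_subset c x).trans hx

lemma ns_exists_F (j : ℕ) : ∃ F : Submodule ℝ (ℝ → ℝ), Module.finrank ℝ F = j ∧
    (∀ χ ∈ F, ContDiff ℝ (⊤ : ℕ∞) χ ∧ HasCompactSupport χ) := by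
  let b : Fin j → ℝ → ℝ := fun i =>
    ((⟨1/4, 1/2, by norm_num, by norm_num⟩ : ContDiffBump (i : ℝ)) : ℝ → ℝ)
  have hb : ∀ i k : Fin j, b i (k : ℝ) = if i = k then 1 else 0 := by
    intro i k
    split_ifs with h
    · subst h
      apply ContDiffBump.one_of_mem_closedBall
      simp
    · apply ContDiffBump.zero_of_le_dist
      have h2 : (i : ℤ) - k ≠ 0 := by
        intro h3; apply h; ext; omega
      have : (1 : ℝ) ≤ |(i : ℝ) - k| := by
        have := Int.one_le_abs h2
        exact_mod_cast this
      rw [dist_comm, Real.dist_eq]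
      show (1/2 : ℝ) ≤ _
      linarith
  have hli : LinearIndependent ℝ b := by
    rw [Fintype.linearIndependent_iff]
    intro g hg k
    have := congrFun hg (k : ℝ)
    simpa [Finset.sum_apply, hb] using this
  refine ⟨Submodule.span ℝ (range b), ?_, ?_⟩
  · rw [finrank_span_eq_card hli]; simp
  · intro χ hχ
    induction hχ using Submodule.span_induction with
    | mem x h =>
      obtain ⟨i, rfl⟩ := h
      exact ⟨ContDiffBump.contDiff _, ContDiffBump.hasCompactSupport _⟩
    | zero => exact ⟨contDiff_const, HasCompactSupport.zero⟩
    | add x y _ _ hx hy => exact ⟨hx.1.add hy.1, hx.2.add hy.2⟩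
    | smul c x _ hx => exact ⟨contDiff_const.smul hx.1, hx.2.smul_left (f := fun _ => c)⟩

lemma ns_st_deriv : (∀ x, x < 0 → deriv smoothTransition x = 0) ∧
    (∀ x, 1 < x → deriv smoothTransition x = 0) ∧ ∃ C, 0 ≤ C ∧ ∀ x, |deriv smoothTransition x| ≤ C := by
  have h1 : ∀ x, x < 0 → deriv smoothTransition x = 0 := by
    intro x hx
    have : smoothTransition =ᶠ[nhds x] fun _ => 0 := by
      filter_upwards [Iio_mem_nhds hx] with y hy
      exact smoothTransition.zero_of_nonpos (le_of_lt hy)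
    rw [this.deriv_eq]; simp
  have h2 : ∀ x, 1 < x → deriv smoothTransition x = 0 := by
    intro x hx
    have : smoothTransition =ᶠ[nhds x] fun _ => 1 := by
      filter_upwards [Ioi_mem_nhds hx] with y hy
      exact smoothTransition.one_of_one_le (le_of_lt hy)
    rw [this.deriv_eq]; simp
  refine ⟨h1, h2, ?_⟩
  have hc : Continuous (deriv smoothTransition) :=
    (smoothTransition.contDiff (n := 1)).continuous_deriv le_rfl
  obtain ⟨C, hC⟩ := isCompact_Icc.exists_bound_of_continuousOn (hc.continuousOn (s := Icc (0:ℝ) 1))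
  refine ⟨C, (norm_nonneg _).trans (hC 0 (by simp)), fun x => ?_⟩
  have hC0 : 0 ≤ C := (norm_nonneg _).trans (hC 0 (by simp))
  by_cases hx : x < 0
  · simp [h1 x hx, hC0]
  by_cases hx1 : 1 < x
  · simp [h2 x hx1, hC0]
  exact hC x ⟨not_lt.1 hx, not_lt.1 hx1⟩

lemma ns_exists_w (κ : ℝ) (hκ : 0 < κ) : ∃ w : ℝ → ℝ, ContDiff ℝ (⊤ : ℕ∞) w ∧
    (∃ s1 s2 : ℝ, 0 < s1 ∧ s2 < 1 ∧ ∀ σ, w σ ≠ 0 → σ ∈ Icc s1 s2) ∧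
    0 < ∫ σ, w σ ^ 2 ∧ ∫ σ, deriv w σ ^ 2 ≤ (π ^ 2 + κ) * ∫ σ, w σ ^ 2 := by
  obtain ⟨z1, z2, C, hC0, hC⟩ := ns_st_deriv
  let w : ℕ → ℝ → ℝ := fun n s => smoothTransition (n * s - 1) * smoothTransition (n * (1 - s) - 1) * sin (π * s)
  have hstD : ∀ x, HasDerivAt smoothTransition (deriv smoothTransition x) x := fun x =>
    ((smoothTransition.contDiff (n := 1)).differentiable one_ne_zero x).hasDerivAt
  let w' : ℕ → ℝ → ℝ := fun n s =>
    ((deriv smoothTransition (n * s - 1) * n) * smoothTransition (n * (1 - s) - 1) +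
      smoothTransition (n * s - 1) * (deriv smoothTransition (n * (1 - s) - 1) * (-n))) * sin (π * s) +
    smoothTransition (n * s - 1) * smoothTransition (n * (1 - s) - 1) * (cos (π * s) * π)
  have hwD : ∀ n s, HasDerivAt (w n) (w' n s) s := by
    intro n s
    have e1 : HasDerivAt (fun s : ℝ => (n : ℝ) * s - 1) n s := by
      simpa using ((hasDerivAt_id s).const_mul (n : ℝ)).sub_const 1
    have e2 : HasDerivAt (fun s : ℝ => (n : ℝ) * (1 - s) - 1) (-n) s := by
      simpa using (((hasDerivAt_id s).const_sub 1).const_mul (n : ℝ)).sub_const 1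
    have e3 : HasDerivAt (fun s : ℝ => sin (π * s)) (cos (π * s) * π) s := by
      simpa using ((hasDerivAt_id s).const_mul π).sin
    exact (((hstD _).comp s e1).mul ((hstD _).comp s e2)).mul e3
  have hst : ContDiff ℝ (⊤ : ℕ∞) smoothTransition := smoothTransition.contDiff
  have hwC : ∀ n, ContDiff ℝ (⊤ : ℕ∞) (w n) := by
    intro n
    refine ((hst.comp ?_).mul (hst.comp ?_)).mul ?_ <;> fun_prop
  have hwd : ∀ n, deriv (w n) = w' n := fun n => funext fun s => (hwD n s).deriv
  have hsupp : ∀ n : ℕ, 1 ≤ n → ∀ σ, w n σ ≠ 0 → σ ∈ Icc (1 / (n:ℝ)) (1 - 1 / (n:ℝ)) := by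
    intro n hn σ hσ
    have hn0 : (0:ℝ) < n := by exact_mod_cast hn
    constructor
    · by_contra hlt
      rw [not_le, lt_div_iff₀ hn0] at hlt
      exact hσ (by simp only [w]; rw [smoothTransition.zero_of_nonpos (by linarith)]; simp)
    · by_contra hlt
      rw [not_le] at hlt
      have : 1 - σ < 1 / (n:ℝ) := by linarith
      rw [lt_div_iff₀ hn0] at this
      exact hσ (by simp only [w]; rw [smoothTransition.zero_of_nonpos (x := n * (1 - σ) - 1) (by linarith)]; simp)
  have hcd : ∀ n, Continuous (w' n) := fun n => by
    rw [← hwd]; exact (hwC n).continuous_deriv (by simp)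
  have hev : ∀ s ∈ Ioo (0:ℝ) 1, ∀ᶠ n : ℕ in atTop, 1 < n * s - 1 ∧ 1 < n * (1 - s) - 1 := by
    intro s hs
    obtain ⟨N1, h1⟩ := exists_nat_gt (2 / s)
    obtain ⟨N2, h2⟩ := exists_nat_gt (2 / (1 - s))
    filter_upwards [eventually_ge_atTop N1, eventually_ge_atTop N2] with n hn1 hn2
    have hs1 : 0 < 1 - s := by linarith [hs.2]
    have g1 : 2 / s < n := h1.trans_le (by exact_mod_cast hn1)
    have g2 : 2 / (1 - s) < n := h2.trans_le (by exact_mod_cast hn2)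
    rw [div_lt_iff₀ hs.1] at g1
    rw [div_lt_iff₀ hs1] at g2
    constructor <;> linarith
  have hae : ∀ᵐ s ∂(volume : Measure ℝ), s ∈ Set.uIoc (0:ℝ) 1 → s ∈ Ioo (0:ℝ) 1 := by
    have : ∀ᵐ s ∂(volume : Measure ℝ), s ≠ 1 := by
      simp [ae_iff]
    filter_upwards [this] with s hs hs2
    rw [uIoc_of_le zero_le_one] at hs2
    exact ⟨hs2.1, lt_of_le_of_ne hs2.2 hs⟩
  have T1 : Tendsto (fun n => ∫ s in (0:ℝ)..1, w n s ^ 2) atTop (nhds (∫ s in (0:ℝ)..1, sin (π * s) ^ 2)) := by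
    apply intervalIntegral.tendsto_integral_filter_of_dominated_convergence (fun _ => 1)
    · exact Eventually.of_forall fun n => ((hwC n).continuous.pow 2).aestronglyMeasurable
    · refine Eventually.of_forall fun n => Eventually.of_forall fun s _ => ?_
      rw [norm_pow]
      apply pow_le_one₀ (norm_nonneg _)
      simp only [w, norm_mul, Real.norm_eq_abs]
      rw [abs_of_nonneg (smoothTransition.nonneg _), abs_of_nonneg (smoothTransition.nonneg _)]
      refine mul_le_one₀ (mul_le_one₀ (smoothTransition.le_one _) (smoothTransition.nonneg _) (smoothTransition.le_one _)) (abs_nonneg _) (abs_sin_le_one _)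
    · exact intervalIntegrable_const
    · filter_upwards [hae] with s hs hs2
      apply tendsto_const_nhds.congr'
      filter_upwards [hev s (hs hs2)] with n hn
      simp only [w]
      rw [smoothTransition.one_of_one_le hn.1.le, smoothTransition.one_of_one_le hn.2.le]; simp
  have T2 : Tendsto (fun n => ∫ s in (0:ℝ)..1, w' n s ^ 2) atTop (nhds (∫ s in (0:ℝ)..1, (cos (π * s) * π) ^ 2)) := by
    apply intervalIntegral.tendsto_integral_filter_of_dominated_convergence (fun _ => (4 * π * C + π) ^ 2)
    · exact Eventually.of_forall fun n => ((hcd n).pow 2).aestronglyMeasurable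
    · refine Eventually.of_forall fun n => ?_
      filter_upwards [hae] with s hs hs2
      have hs := hs hs2
      rw [norm_pow]
      apply pow_le_pow_left₀ (norm_nonneg _)
      rw [Real.norm_eq_abs]
      have hn0 : (0:ℝ) ≤ n := Nat.cast_nonneg n
      have hb1 : |deriv smoothTransition (n * s - 1) * n * sin (π * s)| ≤ 2 * π * C := by
        by_cases hh : 1 < (n:ℝ) * s - 1
        · rw [z2 _ hh]; simp; positivity
        · have hsin : |sin (π * s)| ≤ π * s := by
            have := abs_sin_le_abs (x := π * s)
            rwa [abs_of_nonneg (mul_nonneg pi_pos.le hs.1.le)] at this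
          rw [abs_mul, abs_mul, abs_of_nonneg hn0]
          calc _ ≤ C * n * (π * s) := by
                gcongr
                exact hC _
            _ = C * π * (n * s) := by ring
            _ ≤ C * π * 2 := by gcongr; linarith
            _ = _ := by ring
      have hb2 : |deriv smoothTransition (n * (1 - s) - 1) * n * sin (π * s)| ≤ 2 * π * C := by
        by_cases hh : 1 < (n:ℝ) * (1 - s) - 1
        · rw [z2 _ hh]; simp; positivity
        · have hsin : |sin (π * s)| ≤ π * (1 - s) := by
            have := abs_sin_le_abs (x := π * (1 - s))
            rw [abs_of_nonneg (mul_nonneg pi_pos.le (by linarith [hs.2]))] at this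
            rwa [show π * (1 - s) = π - π * s by ring, sin_pi_sub, show π - π * s = π * (1 - s) by ring] at this
          rw [abs_mul, abs_mul, abs_of_nonneg hn0]
          calc _ ≤ C * n * (π * (1 - s)) := by
                gcongr
                exact hC _
            _ = C * π * (n * (1 - s)) := by ring
            _ ≤ C * π * 2 := by gcongr; linarith
            _ = _ := by ring
      set A := smoothTransition (n * s - 1)
      set B := smoothTransition (n * (1 - s) - 1)
      have hA0 : 0 ≤ A := smoothTransition.nonneg _
      have hA1 : A ≤ 1 := smoothTransition.le_one _
      have hB0 : 0 ≤ B := smoothTransition.nonneg _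
      have hB1 : B ≤ 1 := smoothTransition.le_one _
      have hb3 : |cos (π * s) * π| ≤ π := by
        rw [abs_mul, abs_of_pos pi_pos]
        exact mul_le_of_le_one_left pi_pos.le (abs_cos_le_one _)
      have e : w' n s = B * (deriv smoothTransition (n * s - 1) * n * sin (π * s)) -
          A * (deriv smoothTransition (n * (1 - s) - 1) * n * sin (π * s)) + A * B * (cos (π * s) * π) := by
        simp only [w']; ring
      rw [e]
      have m1 : ∀ t x c : ℝ, 0 ≤ t → t ≤ 1 → |x| ≤ c → |t * x| ≤ c := by
        intro t x c h0 h1 hx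
        rw [abs_mul, abs_of_nonneg h0]
        exact (mul_le_of_le_one_left (abs_nonneg _) h1).trans hx
      have q1 := m1 _ _ _ hB0 hB1 hb1
      have q2 := m1 _ _ _ hA0 hA1 hb2
      have q3 := m1 (A * B) _ _ (mul_nonneg hA0 hB0) (mul_le_one₀ hA1 hB0 hB1) hb3
      rw [abs_le] at q1 q2 q3 ⊢
      constructor <;> linarith [q1.1, q1.2, q2.1, q2.2, q3.1, q3.2]
    · exact intervalIntegrable_const
    · filter_upwards [hae] with s hs hs2
      apply tendsto_const_nhds.congr'
      filter_upwards [hev s (hs hs2)] with n hn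
      simp only [w']
      rw [smoothTransition.one_of_one_le hn.1.le, smoothTransition.one_of_one_le hn.2.le, z2 _ hn.1, z2 _ hn.2]; simp
  have I1 : ∫ s in (0:ℝ)..1, sin (π * s) ^ 2 = 1 / 2 := by
    rw [intervalIntegral.integral_comp_mul_left (fun y => sin y ^ 2) pi_ne_zero]
    simp only [integral_sin_sq]; simp; field_simp
  have I2 : ∫ s in (0:ℝ)..1, (cos (π * s) * π) ^ 2 = π ^ 2 / 2 := by
    have : ∀ s, (cos (π * s) * π) ^ 2 = π ^ 2 * cos (π * s) ^ 2 := fun s => by ring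
    simp_rw [this]
    rw [intervalIntegral.integral_const_mul, intervalIntegral.integral_comp_mul_left (fun y => cos y ^ 2) pi_ne_zero]
    simp only [integral_cos_sq]; simp; field_simp
  rw [I1] at T1
  rw [I2] at T2
  have T3 : Tendsto (fun n => (∫ s in (0:ℝ)..1, w' n s ^ 2) - (π ^ 2 + κ) * (∫ s in (0:ℝ)..1, w n s ^ 2)) atTop
      (nhds (π ^ 2 / 2 - (π ^ 2 + κ) * (1 / 2))) := T2.sub (T1.const_mul _)
  have ev1 := T3.eventually_lt_const (u := 0) (by linarith)
  have ev2 := T1.eventually_const_lt (u := 0) (by norm_num)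
  obtain ⟨n, hn1, hn2, hn3⟩ := (ev1.and (ev2.and (eventually_ge_atTop 1))).exists
  have hn0 : (0:ℝ) < n := by exact_mod_cast hn3
  have hs := hsupp n hn3
  have hsub : Icc (1 / (n:ℝ)) (1 - 1 / (n:ℝ)) ⊆ Ioc 0 1 := fun x hx =>
    ⟨lt_of_lt_of_le (by positivity) hx.1, hx.2.trans (by linarith [show 0 < 1 / (n:ℝ) by positivity])⟩
  have J1 : ∫ σ, w n σ ^ 2 = ∫ s in (0:ℝ)..1, w n s ^ 2 := by
    symm
    apply intervalIntegral.integral_eq_integral_of_support_subset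
    intro σ hσ
    exact hsub (hs σ (by simpa using hσ))
  have J2 : ∫ σ, deriv (w n) σ ^ 2 = ∫ s in (0:ℝ)..1, w' n s ^ 2 := by
    rw [hwd]
    symm
    apply intervalIntegral.integral_eq_integral_of_support_subset
    intro σ hσ
    have : σ ∈ Function.support (deriv (w n)) := by rw [hwd]; simpa using hσ
    have h2 := support_deriv_subset this
    exact hsub (closure_minimal (fun x hx => hs x hx) isClosed_Icc h2)
  refine ⟨w n, hwC n, ⟨1 / n, 1 - 1 / n, by positivity, by linarith [show 0 < 1 / (n:ℝ) by positivity], hs⟩, ?_, ?_⟩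
  · rw [J1]; exact hn2
  · rw [J1, J2]; linarith

lemma ns_hasDeriv_x (ψ : ℝ × ℝ → ℝ) (hψ : ContDiff ℝ (⊤ : ℕ∞) ψ) (x y : ℝ) :
    HasDerivAt (fun s => ψ (s, y)) (fderiv ℝ ψ (x, y) (1, 0)) x := by
  have h1 : HasFDerivAt ψ (fderiv ℝ ψ (x, y)) (x, y) := (hψ.differentiable (by simp) _).hasFDerivAt
  have h2 : HasDerivAt (fun s : ℝ => (s, y)) ((1 : ℝ), (0 : ℝ)) x :=
    (hasDerivAt_id x).prodMk (hasDerivAt_const x y)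
  exact h1.comp_hasDerivAt x h2

lemma ns_hasDeriv_y (ψ : ℝ × ℝ → ℝ) (hψ : ContDiff ℝ (⊤ : ℕ∞) ψ) (x y : ℝ) :
    HasDerivAt (fun s => ψ (x, s)) (fderiv ℝ ψ (x, y) (0, 1)) y := by
  have h1 : HasFDerivAt ψ (fderiv ℝ ψ (x, y)) (x, y) := (hψ.differentiable (by simp) _).hasFDerivAt
  have h2 : HasDerivAt (fun s : ℝ => (x, s)) ((0 : ℝ), (1 : ℝ)) y :=
    (hasDerivAt_const y x).prodMk (hasDerivAt_id y)
  exact h1.comp_hasDerivAt y h2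

lemma ns_gradSq_eq (ψ : ℝ × ℝ → ℝ) (hψ : ContDiff ℝ (⊤ : ℕ∞) ψ) (p : ℝ × ℝ) :
    gradSq ψ p = (fderiv ℝ ψ p (1, 0)) ^ 2 + (fderiv ℝ ψ p (0, 1)) ^ 2 := by
  unfold gradSq
  rw [(ns_hasDeriv_x ψ hψ p.1 p.2).deriv, (ns_hasDeriv_y ψ hψ p.1 p.2).deriv]

lemma ns_fd_smooth (ψ : ℝ × ℝ → ℝ) (hψ : ContDiff ℝ (⊤ : ℕ∞) ψ) (v : ℝ × ℝ) :
    ContDiff ℝ (⊤ : ℕ∞) (fun p => fderiv ℝ ψ p v) :=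
  (hψ.fderiv_right (m := (⊤ : ℕ∞)) (by simp)).clm_apply contDiff_const

lemma ns_fd_supp (ψ : ℝ × ℝ → ℝ) (v : ℝ × ℝ) :
    tsupport (fun p => fderiv ℝ ψ p v) ⊆ tsupport ψ := by
  apply closure_minimal _ (isClosed_tsupport _)
  intro p hp
  apply support_fderiv_subset ℝ (f := ψ)
  intro h
  apply hp
  simp [h]

lemma ns_fd_cs (ψ : ℝ × ℝ → ℝ) (hs : HasCompactSupport ψ) (v : ℝ × ℝ) :
    HasCompactSupport (fun p => fderiv ℝ ψ p v) :=
  hs.mono' ((subset_tsupport _).trans (ns_fd_supp ψ v))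

lemma ns_param_deriv (ψ : ℝ × ℝ → ℝ) (hψ : ContDiff ℝ (⊤ : ℕ∞) ψ) (hs : HasCompactSupport ψ)
    (φ : ℝ → ℝ) (hφ : Continuous φ) (x : ℝ) :
    HasDerivAt (fun x => ∫ y, ψ (x, y) * φ y) (∫ y, fderiv ℝ ψ (x, y) (1, 0) * φ y) x := by
  have hd := ns_fd_smooth ψ hψ (1, 0)
  have hdc := ns_fd_cs ψ hs (1, 0)
  obtain ⟨R, hR⟩ := hs.isCompact.isBounded.subset_closedBall 0
  obtain ⟨C, hC⟩ := hd.continuous.bounded_above_of_compact_support hdc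
  have hz : ∀ x y, y ∉ Icc (-R) R → fderiv ℝ ψ (x, y) (1, 0) = 0 := by
    intro x y hy
    by_contra hne
    have h1 := hR (ns_fd_supp ψ (1, 0) (subset_tsupport _ hne))
    rw [mem_closedBall_zero_iff, Prod.norm_def] at h1
    have h2 : |y| ≤ R := (le_max_right _ _).trans h1
    exact hy (abs_le.1 h2)
  have hsl : ∀ x, HasCompactSupport (fun y => ψ (x, y)) := by
    intro x
    apply HasCompactSupport.of_support_subset_isCompact (isCompact_closedBall (0:ℝ) R)
    intro y hy
    have h1 := hR (subset_tsupport ψ (show (x, y) ∈ Function.support ψ from hy))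
    rw [mem_closedBall_zero_iff, Prod.norm_def] at h1
    simpa using (le_max_right _ _).trans h1
  have hc1 : ∀ x, Continuous (fun y => ψ (x, y) * φ y) := fun x =>
    (hψ.continuous.comp (by fun_prop)).mul hφ
  have hc2 : ∀ x, Continuous (fun y => fderiv ℝ ψ (x, y) (1, 0) * φ y) := fun x =>
    (hd.continuous.comp (by fun_prop : Continuous fun y : ℝ => (x, y))).mul hφ
  have := hasDerivAt_integral_of_dominated_loc_of_deriv_le (μ := volume) (s := univ) (x₀ := x)
    (F := fun x y => ψ (x, y) * φ y) (F' := fun x y => fderiv ℝ ψ (x, y) (1, 0) * φ y)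
    (bound := (Icc (-R) R).indicator (fun y => C * |φ y|)) univ_mem
    (Eventually.of_forall fun x => (hc1 x).aestronglyMeasurable)
    ((hc1 x).integrable_of_hasCompactSupport ((hsl x).mul_right))
    (hc2 x).aestronglyMeasurable
    (Eventually.of_forall fun y x _ => by
      by_cases hy : y ∈ Icc (-R) R
      · rw [indicator_of_mem hy, norm_mul]
        exact mul_le_mul_of_nonneg_right (hC _) (norm_nonneg _)
      · rw [indicator_of_notMem hy, hz x y hy]; simp)
    ((ContinuousOn.integrableOn_compact isCompact_Icc (by fun_prop)).integrable_indicator measurableSet_Icc)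
    (Eventually.of_forall fun y x _ => (ns_hasDeriv_x ψ hψ x y).mul_const _)
  exact this.2

lemma ns_param_smooth (φ : ℝ → ℝ) (hφ : Continuous φ) (n : ℕ) :
    ∀ (ψ : ℝ × ℝ → ℝ) (_ : ContDiff ℝ (⊤ : ℕ∞) ψ) (_ : HasCompactSupport ψ),
    ContDiff ℝ n (fun x => ∫ y, ψ (x, y) * φ y) := by
  induction n with
  | zero =>
    intro ψ hψ hs
    have : Continuous (fun x => ∫ y, ψ (x, y) * φ y) :=
      continuous_iff_continuousAt.2 fun x => (ns_param_deriv ψ hψ hs φ hφ x).continuousAt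
    exact contDiff_zero.2 this
  | succ n ih =>
    intro ψ hψ hs
    have : ((n + 1 : ℕ) : WithTop ℕ∞) = (n : WithTop ℕ∞) + 1 := by simp
    rw [this, contDiff_succ_iff_deriv]
    refine ⟨fun x => (ns_param_deriv ψ hψ hs φ hφ x).differentiableAt, by simp, ?_⟩
    have e : deriv (fun x => ∫ y, ψ (x, y) * φ y) = fun x => ∫ y, fderiv ℝ ψ (x, y) (1, 0) * φ y :=
      funext fun x => (ns_param_deriv ψ hψ hs φ hφ x).deriv
    rw [e]
    exact ih _ (ns_fd_smooth ψ hψ (1, 0)) (ns_fd_cs ψ hs (1, 0))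

lemma ns_param_smooth' (φ : ℝ → ℝ) (hφ : Continuous φ)
    (ψ : ℝ × ℝ → ℝ) (hψ : ContDiff ℝ (⊤ : ℕ∞) ψ) (hs : HasCompactSupport ψ) :
    ContDiff ℝ (⊤ : ℕ∞) (fun x => ∫ y, ψ (x, y) * φ y) :=
  contDiff_infty.2 fun n => ns_param_smooth φ hφ n ψ hψ hs

lemma ns_sq_int {X : Type*} [TopologicalSpace X] [MeasurableSpace X] [BorelSpace X] (μ : Measure X)
    [IsFiniteMeasureOnCompacts μ] (f g : X → ℝ) (hf : Continuous f) (hg : Continuous g) (hs : HasCompactSupport f) :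
    Integrable (fun x => f x * g x) μ :=
  (hf.mul hg).integrable_of_hasCompactSupport hs.mul_right

lemma ns_grad_int (ψ : ℝ × ℝ → ℝ) (hψ : ContDiff ℝ (⊤ : ℕ∞) ψ) (hs : HasCompactSupport ψ) :
    Integrable (gradSq ψ) := by
  have : gradSq ψ = fun p => (fderiv ℝ ψ p (1, 0)) * (fderiv ℝ ψ p (1, 0)) + (fderiv ℝ ψ p (0, 1)) * (fderiv ℝ ψ p (0, 1)) := by
    ext p; rw [ns_gradSq_eq ψ hψ]; ring
  rw [this]
  exact (ns_sq_int _ _ _ (ns_fd_smooth ψ hψ _).continuous (ns_fd_smooth ψ hψ _).continuous (ns_fd_cs ψ hs _)).add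
    (ns_sq_int _ _ _ (ns_fd_smooth ψ hψ _).continuous (ns_fd_smooth ψ hψ _).continuous (ns_fd_cs ψ hs _))

lemma ns_set_int (Ω : Set (ℝ × ℝ)) (ψ : ℝ × ℝ → ℝ) (hψ : ContDiff ℝ (⊤ : ℕ∞) ψ) (ht : tsupport ψ ⊆ Ω) :
    (∫ p in Ω, gradSq ψ p) = (∫ p, gradSq ψ p) ∧ (∫ p in Ω, (ψ p) ^ 2) = ∫ p, (ψ p) ^ 2 := by
  constructor
  · apply setIntegral_eq_integral_of_forall_compl_eq_zero
    intro p hp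
    rw [ns_gradSq_eq ψ hψ]
    have : ∀ v, fderiv ℝ ψ p v = 0 := fun v => by
      by_contra hne
      exact hp (ht (ns_fd_supp ψ v (subset_tsupport _ hne)))
    simp [this]
  · apply setIntegral_eq_integral_of_forall_compl_eq_zero
    intro p hp
    have : ψ p = 0 := by
      by_contra hne
      exact hp (ht (subset_tsupport _ hne))
    simp [this]

lemma ns_finrank_ne {V : Type*} [AddCommGroup V] [Module ℝ V] (F : Submodule ℝ V) (j : ℕ) (hj : 1 ≤ j)
    (h : Module.finrank ℝ F = j) : FiniteDimensional ℝ F ∧ ∃ v ∈ F, v ≠ 0 := by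
  have h0 : 0 < Module.finrank ℝ F := by omega
  refine ⟨Module.finite_of_finrank_pos h0, ?_⟩
  have := Module.nontrivial_of_finrank_pos h0
  obtain ⟨v, hv⟩ := exists_ne (0 : F)
  exact ⟨v, v.2, by simpa using hv⟩

lemma ns_dir_lower (Ω : Set (ℝ × ℝ)) (j : ℕ) (hj : 1 ≤ j) (τ : ℝ)
    (hne : ∃ F : Submodule ℝ ((ℝ × ℝ) → ℝ), Module.finrank ℝ F = j ∧
      (∀ ψ ∈ F, ContDiff ℝ (⊤ : ℕ∞) ψ ∧ HasCompactSupport ψ ∧ tsupport ψ ⊆ Ω))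
    (H : ∀ F : Submodule ℝ ((ℝ × ℝ) → ℝ), Module.finrank ℝ F = j →
      (∀ ψ ∈ F, ContDiff ℝ (⊤ : ℕ∞) ψ ∧ HasCompactSupport ψ ∧ tsupport ψ ⊆ Ω) →
      ∃ ψ ∈ F, ψ ≠ 0 ∧ τ * (∫ p, ψ p ^ 2) ≤ ∫ p, gradSq ψ p) :
    τ ≤ dirichletMinMax Ω j := by
  apply le_csInf
  · obtain ⟨F, h1, h2⟩ := hne
    exact ⟨_, F, h1, h2, rfl⟩
  rintro r ⟨F, h1, h2, rfl⟩
  obtain ⟨ψ, hψF, hψ0, hψ⟩ := H F h1 h2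
  obtain ⟨hfd, -⟩ := ns_finrank_ne F j hj h1
  have hpos : ∀ ψ ∈ F, ψ ≠ 0 → 0 < ∫ p, ψ p ^ 2 := fun ψ h h0 =>
    ns_sq_pos volume ψ (h2 ψ h).1.continuous (h2 ψ h).2.1 h0
  have hlin : ∀ v : ℝ × ℝ, ∃ D : F →ₗ[ℝ] ((ℝ × ℝ) → ℝ), ∀ ψ : F, ∀ p, D ψ p = fderiv ℝ (ψ : ℝ × ℝ → ℝ) p v := by
    intro v
    refine ⟨{ toFun := fun ψ p => fderiv ℝ (ψ : ℝ × ℝ → ℝ) p v, map_add' := ?_, map_smul' := ?_ }, fun _ _ => rfl⟩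
    · intro a b
      ext p
      have := fderiv_add (((h2 a a.2).1.differentiable (by simp)) p) (((h2 b b.2).1.differentiable (by simp)) p)
      simp [this]
    · intro c a
      ext p
      have := fderiv_const_smul (((h2 a a.2).1.differentiable (by simp)) p) c
      simp [this]
  obtain ⟨D1, hD1⟩ := hlin (1, 0)
  obtain ⟨D2, hD2⟩ := hlin (0, 1)
  obtain ⟨C, hC⟩ := ns_form_bdd (volume : Measure (ℝ × ℝ)) D1 D2 F.subtype
    (fun v w => by
      simp only [hD1]
      exact ns_sq_int _ _ _ (ns_fd_smooth _ (h2 v v.2).1 _).continuous (ns_fd_smooth _ (h2 w w.2).1 _).continuous (ns_fd_cs _ (h2 v v.2).2.1 _))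
    (fun v w => by
      simp only [hD2]
      exact ns_sq_int _ _ _ (ns_fd_smooth _ (h2 v v.2).1 _).continuous (ns_fd_smooth _ (h2 w w.2).1 _).continuous (ns_fd_cs _ (h2 v v.2).2.1 _))
    (fun v w => ns_sq_int _ _ _ (h2 v v.2).1.continuous (h2 w w.2).1.continuous (h2 v v.2).2.1)
    (fun v hv => hpos v v.2 (by simpa using hv))
  have hb : BddAbove { s : ℝ | ∃ ψ ∈ F, ψ ≠ (0 : (ℝ × ℝ) → ℝ) ∧
      s = (∫ p in Ω, gradSq ψ p) / (∫ p in Ω, (ψ p) ^ 2) } := by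
    refine ⟨C, ?_⟩
    rintro s ⟨ψ, hF, h0, rfl⟩
    obtain ⟨e1, e2⟩ := ns_set_int Ω ψ (h2 ψ hF).1 (h2 ψ hF).2.2
    rw [e1, e2, div_le_iff₀ (hpos ψ hF h0)]
    have := hC ⟨ψ, hF⟩
    simp only [hD1, hD2] at this
    simp_rw [ns_gradSq_eq ψ (h2 ψ hF).1]
    exact this
  refine le_trans ?_ (le_csSup hb ⟨ψ, hψF, hψ0, rfl⟩)
  obtain ⟨e1, e2⟩ := ns_set_int Ω ψ (h2 ψ hψF).1 (h2 ψ hψF).2.2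
  rw [e1, e2, le_div_iff₀ (hpos ψ hψF hψ0)]
  exact hψ

lemma ns_dir_upper (Ω : Set (ℝ × ℝ)) (j : ℕ) (hj : 1 ≤ j) (τ : ℝ)
    (F : Submodule ℝ ((ℝ × ℝ) → ℝ)) (h1 : Module.finrank ℝ F = j)
    (h2 : ∀ ψ ∈ F, ContDiff ℝ (⊤ : ℕ∞) ψ ∧ HasCompactSupport ψ ∧ tsupport ψ ⊆ Ω)
    (H : ∀ ψ ∈ F, ∫ p, gradSq ψ p ≤ τ * (∫ p, ψ p ^ 2)) :
    dirichletMinMax Ω j ≤ τ := by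
  have hbb : BddBelow { r : ℝ | ∃ F : Submodule ℝ ((ℝ × ℝ) → ℝ),
    Module.finrank ℝ F = j ∧
    (∀ ψ ∈ F, ContDiff ℝ (⊤ : ℕ∞) ψ ∧ HasCompactSupport ψ ∧ tsupport ψ ⊆ Ω) ∧
    r = sSup { s : ℝ | ∃ ψ ∈ F, ψ ≠ (0 : (ℝ × ℝ) → ℝ) ∧
      s = (∫ p in Ω, gradSq ψ p) / (∫ p in Ω, (ψ p) ^ 2) } } := by
    refine ⟨0, ?_⟩
    rintro r ⟨F, -, -, rfl⟩
    apply Real.sSup_nonneg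
    rintro s ⟨ψ, -, -, rfl⟩
    apply div_nonneg
    · exact integral_nonneg fun p => add_nonneg (sq_nonneg _) (sq_nonneg _)
    · exact integral_nonneg fun p => sq_nonneg _
  refine (csInf_le hbb ⟨F, h1, h2, rfl⟩).trans ?_
  obtain ⟨-, ψ, hψ, h0⟩ := ns_finrank_ne F j hj h1
  apply csSup_le
  · exact ⟨_, ψ, hψ, h0, rfl⟩
  rintro s ⟨ψ, hF, h0, rfl⟩
  obtain ⟨e1, e2⟩ := ns_set_int Ω ψ (h2 ψ hF).1 (h2 ψ hF).2.2
  rw [e1, e2, div_le_iff₀ (ns_sq_pos volume ψ (h2 ψ hF).1.continuous (h2 ψ hF).2.1 h0)]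
  exact H ψ hF

lemma ns_sch_nonneg (q : ℝ → ℝ) (hq0 : ∀ x, 0 ≤ q x) (j : ℕ) : 0 ≤ schroedingerMinMax q j := by
  apply Real.sInf_nonneg
  rintro r ⟨F, -, -, rfl⟩
  apply Real.sSup_nonneg
  rintro s ⟨ψ, -, -, rfl⟩
  apply div_nonneg
  · exact integral_nonneg fun p => add_nonneg (sq_nonneg _) (mul_nonneg (hq0 _) (sq_nonneg _))
  · exact integral_nonneg fun p => sq_nonneg _

lemma ns_sch_lower (q : ℝ → ℝ) (hq0 : ∀ x, 0 ≤ q x) (j : ℕ) (hj : 1 ≤ j) (δ : ℝ) (hδ : 0 < δ)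
    (F : Submodule ℝ (ℝ → ℝ)) (h1 : Module.finrank ℝ F = j)
    (h2 : ∀ χ ∈ F, ContDiff ℝ (⊤ : ℕ∞) χ ∧ HasCompactSupport χ) :
    ∃ χ ∈ F, χ ≠ 0 ∧ (schroedingerMinMax q j - δ) * (∫ x, χ x ^ 2) ≤ ∫ x, (deriv χ x ^ 2 + q x * χ x ^ 2) := by
  have hbb : BddBelow { r : ℝ | ∃ F : Submodule ℝ (ℝ → ℝ),
    Module.finrank ℝ F = j ∧
    (∀ χ ∈ F, ContDiff ℝ (⊤ : ℕ∞) χ ∧ HasCompactSupport χ) ∧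
    r = sSup { s : ℝ | ∃ χ ∈ F, χ ≠ (0 : ℝ → ℝ) ∧
      s = (∫ x : ℝ, (deriv χ x ^ 2 + q x * χ x ^ 2)) / (∫ x : ℝ, χ x ^ 2) } } := by
    refine ⟨0, ?_⟩
    rintro r ⟨F, -, -, rfl⟩
    apply Real.sSup_nonneg
    rintro s ⟨ψ, -, -, rfl⟩
    apply div_nonneg
    · exact integral_nonneg fun p => add_nonneg (sq_nonneg _) (mul_nonneg (hq0 _) (sq_nonneg _))
    · exact integral_nonneg fun p => sq_nonneg _
  have h3 := csInf_le hbb ⟨F, h1, h2, rfl⟩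
  change schroedingerMinMax q j ≤ _ at h3
  obtain ⟨-, ψ, hψ, h0⟩ := ns_finrank_ne F j hj h1
  obtain ⟨s, ⟨χ, hχ, hχ0, rfl⟩, hs⟩ := exists_lt_of_lt_csSup (by exact ⟨_, ψ, hψ, h0, rfl⟩)
    (lt_of_lt_of_le (sub_lt_self (schroedingerMinMax q j) hδ) h3)
  refine ⟨χ, hχ, hχ0, ?_⟩
  rw [lt_div_iff₀ (ns_sq_pos volume χ (h2 χ hχ).1.continuous (h2 χ hχ).2 hχ0)] at hs
  exact hs.le

lemma ns_sch_upper (q : ℝ → ℝ) (hq0 : ∀ x, 0 ≤ q x) (hqc : Continuous q) (j : ℕ) (hj : 1 ≤ j) (δ : ℝ) (hδ : 0 < δ) :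
    ∃ F : Submodule ℝ (ℝ → ℝ), Module.finrank ℝ F = j ∧
    (∀ χ ∈ F, ContDiff ℝ (⊤ : ℕ∞) χ ∧ HasCompactSupport χ) ∧
    ∀ χ ∈ F, ∫ x, (deriv χ x ^ 2 + q x * χ x ^ 2) ≤ (schroedingerMinMax q j + δ) * (∫ x, χ x ^ 2) := by
  have hne : { r : ℝ | ∃ F : Submodule ℝ (ℝ → ℝ),
    Module.finrank ℝ F = j ∧
    (∀ χ ∈ F, ContDiff ℝ (⊤ : ℕ∞) χ ∧ HasCompactSupport χ) ∧
    r = sSup { s : ℝ | ∃ χ ∈ F, χ ≠ (0 : ℝ → ℝ) ∧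
      s = (∫ x : ℝ, (deriv χ x ^ 2 + q x * χ x ^ 2)) / (∫ x : ℝ, χ x ^ 2) } }.Nonempty := by
    obtain ⟨F, h1, h2⟩ := ns_exists_F j
    exact ⟨_, F, h1, h2, rfl⟩
  obtain ⟨r, ⟨F, h1, h2, rfl⟩, hr⟩ := exists_lt_of_csInf_lt hne
    (show schroedingerMinMax q j < schroedingerMinMax q j + δ by linarith)
  refine ⟨F, h1, h2, ?_⟩
  obtain ⟨hfd, -⟩ := ns_finrank_ne F j hj h1
  have hpos : ∀ ψ ∈ F, ψ ≠ 0 → 0 < ∫ p, ψ p ^ 2 := fun ψ h h0 =>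
    ns_sq_pos volume ψ (h2 ψ h).1.continuous (h2 ψ h).2 h0
  let D1 : F →ₗ[ℝ] (ℝ → ℝ) := { 
    toFun := fun ψ => deriv (ψ : ℝ → ℝ)
    map_add' := by
      intro a b
      ext p
      have := deriv_add (((h2 a a.2).1.differentiable (by simp)) p) (((h2 b b.2).1.differentiable (by simp)) p)
      simpa using this
    map_smul' := by
      intro c a
      ext p
      have := deriv_const_smul c (((h2 a a.2).1.differentiable (by simp)) p)
      simpa using this }
  let D2 : F →ₗ[ℝ] (ℝ → ℝ) := { 
    toFun := fun ψ x => √(q x) * (ψ : ℝ → ℝ) x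
    map_add' := by
      intro a b
      ext p
      simp; ring
    map_smul' := by
      intro c a
      ext p
      simp; ring }
  have cD : ∀ v : F, Continuous (deriv (v : ℝ → ℝ)) := fun v => (h2 v v.2).1.continuous_deriv (by simp)
  have cv : ∀ v : F, Continuous (v : ℝ → ℝ) := fun v => (h2 v v.2).1.continuous
  obtain ⟨C, hC⟩ := ns_form_bdd (volume : Measure ℝ) D1 D2 F.subtype
    (fun v w => ns_sq_int _ _ _ (cD v) (cD w) (h2 v v.2).2.deriv)
    (fun v w => ns_sq_int _ _ _ (hqc.sqrt.mul (cv v)) (hqc.sqrt.mul (cv w)) (h2 v v.2).2.mul_left)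
    (fun v w => ns_sq_int _ _ _ (cv v) (cv w) (h2 v v.2).2)
    (fun v hv => hpos v v.2 (by simpa using hv))
  have hb : BddAbove { s : ℝ | ∃ χ ∈ F, χ ≠ (0 : ℝ → ℝ) ∧
      s = (∫ x : ℝ, (deriv χ x ^ 2 + q x * χ x ^ 2)) / (∫ x : ℝ, χ x ^ 2) } := by
    refine ⟨C, ?_⟩
    rintro s ⟨ψ, hF, h0, rfl⟩
    rw [div_le_iff₀ (hpos ψ hF h0)]
    have := hC ⟨ψ, hF⟩
    simp only [D1, D2, LinearMap.coe_mk, AddHom.coe_mk, mul_pow, Real.sq_sqrt (hq0 _)] at this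
    exact this
  intro χ hχ
  by_cases h0 : χ = 0
  · simp [h0]
  have := (le_csSup hb ⟨χ, hχ, h0, rfl⟩).trans hr.le
  rwa [div_le_iff₀ (hpos χ hχ h0)] at this

lemma ns_fubini (f : ℝ × ℝ → ℝ) (hf : Integrable f) :
    (∫ p, f p) = (∫ x, ∫ y, f (x, y)) ∧ Integrable (fun x => ∫ y, f (x, y)) := by
  rw [Measure.volume_eq_prod] at hf ⊢
  exact ⟨integral_prod f hf, hf.integral_prod_left⟩

/-- regularity of the trial function -/
lemma ns_trial_reg (Ω : Set (ℝ × ℝ)) (ε ρ R M : ℝ) (hε : 0 < ε) (hρ : 0 < ρ)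
    (k w χ : ℝ → ℝ) (hk : ContDiff ℝ (⊤ : ℕ∞) k) (hw : ContDiff ℝ (⊤ : ℕ∞) w) (hχ : ContDiff ℝ (⊤ : ℕ∞) χ)
    (s1 s2 : ℝ) (hs1 : 0 < s1) (hs2 : s2 < 1) (hws : ∀ σ, w σ ≠ 0 → σ ∈ Icc s1 s2)
    (hR : tsupport χ ⊆ Icc (-R) R)
    (hM : 0 < M) (hkM : ∀ t ∈ Icc (-R) R, 1 / M ≤ k t)
    (hΩ : ∀ x y, x / ρ ∈ Icc (-R) R → 0 < y → y * k (x / ρ) < ε → (x, y) ∈ Ω) :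
    ContDiff ℝ (⊤ : ℕ∞) (fun p : ℝ × ℝ => χ (p.1 / ρ) * w (p.2 * k (p.1 / ρ) / ε)) ∧
    HasCompactSupport (fun p : ℝ × ℝ => χ (p.1 / ρ) * w (p.2 * k (p.1 / ρ) / ε)) ∧
    tsupport (fun p : ℝ × ℝ => χ (p.1 / ρ) * w (p.2 * k (p.1 / ρ) / ε)) ⊆ Ω := by
  set ψ : ℝ × ℝ → ℝ := fun p : ℝ × ℝ => χ (p.1 / ρ) * w (p.2 * k (p.1 / ρ) / ε)
  have hc : ContDiff ℝ (⊤ : ℕ∞) ψ := by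
    have e1 : ContDiff ℝ (⊤ : ℕ∞) (fun p : ℝ × ℝ => p.1 / ρ) := contDiff_fst.div_const _
    exact (hχ.comp e1).mul (hw.comp ((contDiff_snd.mul (hk.comp e1)).div_const _))
  let Kc : Set (ℝ × ℝ) := {p | p.1 / ρ ∈ Icc (-R) R ∧ p.2 * k (p.1 / ρ) / ε ∈ Icc s1 s2}
  have hKc : IsClosed Kc := by
    have c1 : Continuous (fun p : ℝ × ℝ => p.1 / ρ) := by fun_prop
    have c2 : Continuous (fun p : ℝ × ℝ => p.2 * k (p.1 / ρ) / ε) := by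
      have := hk.continuous
      fun_prop
    exact (isClosed_Icc.preimage c1).inter (isClosed_Icc.preimage c2)
  have hsub : tsupport ψ ⊆ Kc := by
    apply closure_minimal _ hKc
    intro p hp
    have hp' : χ (p.1 / ρ) * w (p.2 * k (p.1 / ρ) / ε) ≠ 0 := hp
    exact ⟨hR (subset_tsupport _ (left_ne_zero_of_mul hp')), hws _ (right_ne_zero_of_mul hp')⟩
  have hy : ∀ p ∈ Kc, 0 < p.2 ∧ p.2 * k (p.1 / ρ) < ε := by
    rintro p ⟨h1, h2⟩
    have kp : 0 < k (p.1 / ρ) := lt_of_lt_of_le (by positivity) (hkM _ h1)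
    have g1 := lt_of_lt_of_le hs1 h2.1
    have g2 := lt_of_le_of_lt h2.2 hs2
    rw [div_lt_one hε] at g2
    have g3 : 0 < p.2 * k (p.1 / ρ) := by
      have := mul_pos g1 hε
      rwa [div_mul_cancel₀ _ hε.ne'] at this
    exact ⟨pos_of_mul_pos_left g3 kp.le, g2⟩
  have hcomp : IsCompact Kc := by
    apply (isCompact_Icc.prod isCompact_Icc : IsCompact (Icc (-(R * ρ)) (R * ρ) ×ˢ Icc 0 (ε * M))).of_isClosed_subset hKc
    intro p hp
    have h3 := hy p hp
    obtain ⟨h1, h2⟩ := hp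
    refine ⟨⟨?_, ?_⟩, h3.1.le, ?_⟩
    · have := (le_div_iff₀ hρ).1 h1.1; linarith
    · exact (div_le_iff₀ hρ).1 h1.2
    · have h4 := mul_le_mul_of_nonneg_left (hkM _ h1) h3.1.le
      have h5 : p.2 * (1 / M) ≤ ε := h4.trans h3.2.le
      rw [mul_one_div, div_le_iff₀ hM] at h5
      exact h5
  refine ⟨hc, hcomp.of_isClosed_subset (isClosed_tsupport _) hsub, fun p hp => ?_⟩
  have h1 := hsub hp
  have h2 := hy p h1
  exact hΩ p.1 p.2 h1.1 h2.1 h2.2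

set_option maxHeartbeats 2000000 in
lemma ns_trial_energy (ε ρ R M s θ κ : ℝ) (hκ : 0 < κ) (hε : 0 < ε) (hρ : 0 < ρ) (hs : 0 < s) (hθ : 0 < θ)
    (hsρ : s * ρ ^ 2 = ε ^ 2)
    (v w χ q : ℝ → ℝ) (hv : ContDiff ℝ (⊤ : ℕ∞) v) (hw : ContDiff ℝ (⊤ : ℕ∞) w) (hχ : ContDiff ℝ (⊤ : ℕ∞) χ)
    (hχs : HasCompactSupport χ) (hqc : Continuous q) (hq0 : ∀ x, 0 ≤ q x)
    (s1 s2 : ℝ) (hs1 : 0 < s1) (hs2 : s2 < 1) (hws : ∀ σ, w σ ≠ 0 → σ ∈ Icc s1 s2)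
    (hW0 : 0 < ∫ σ, w σ ^ 2) (hW1 : ∫ σ, deriv w σ ^ 2 ≤ (π ^ 2 + κ) * ∫ σ, w σ ^ 2)
    (hR : tsupport χ ⊆ Icc (-R) R) (hM : 0 < M)
    (hk1 : ∀ t ∈ Icc (-R) R, 1 / M ≤ 1 / M + s * v t)
    (hk2 : ∀ t ∈ Icc (-R) R, 1 / M + s * v t ≤ (1 + θ) / M)
    (hbr : ∀ t ∈ Icc (-R) R, (1 + 1 / θ) * (s * deriv v t / (1 / M + s * v t)) ^ 2 * (π ^ 2 + κ) +
      ((1 / M + s * v t) ^ 2 * (π ^ 2 + κ) - π ^ 2 / M ^ 2) / s ≤ q t + 2 * θ)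
    (ν : ℝ) (hν : 0 ≤ ν) (hχν : ∫ x, (deriv χ x ^ 2 + q x * χ x ^ 2) ≤ ν * ∫ x, χ x ^ 2)
    (ψ : ℝ × ℝ → ℝ) (hψdef : ψ = fun p : ℝ × ℝ => χ (p.1 / ρ) * w (p.2 * (1 / M + s * v (p.1 / ρ)) / ε))
    (hψ : ContDiff ℝ (⊤ : ℕ∞) ψ) (hψs : HasCompactSupport ψ) :
    ∫ p, gradSq ψ p ≤ (π ^ 2 / (M ^ 2 * ε ^ 2) + (1 + θ) * ((1 + θ) * ν + 2 * θ) / ρ ^ 2) * ∫ p, ψ p ^ 2 := by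
  set k : ℝ → ℝ := fun t => 1 / M + s * v t with hk
  set W0 := ∫ σ, w σ ^ 2 with hW0d
  have hwcs : HasCompactSupport w := HasCompactSupport.of_support_subset_isCompact isCompact_Icc (fun σ h => hws σ h)
  have hχ0 : ∀ t, t ∉ Icc (-R) R → χ t = 0 ∧ deriv χ t = 0 := by
    intro t ht
    constructor
    · by_contra h; exact ht (hR (subset_tsupport _ h))
    · by_contra h; exact ht (hR (support_deriv_subset h))
  have hkp : ∀ t ∈ Icc (-R) R, 0 < k t := fun t ht => lt_of_lt_of_le (by positivity) (hk1 t ht)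
  have hkinv : ∀ t ∈ Icc (-R) R, (k t)⁻¹ ≤ M ∧ M / (1 + θ) ≤ (k t)⁻¹ := by
    intro t ht
    have h1 := hk1 t ht
    have h2 := hk2 t ht
    change 1 / M ≤ k t at h1
    change k t ≤ (1 + θ) / M at h2
    have h3 := hkp t ht
    constructor
    · rw [inv_le_comm₀ h3 hM]; simpa using h1
    · rw [le_inv_comm₀ (by positivity) h3]; simpa using h2
  -- derivatives
  have hkD : ∀ t, HasDerivAt k (s * deriv v t) t := fun t =>
    (((hv.differentiable (by simp) t).hasDerivAt.const_mul s).const_add _)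
  have hgrad : ∀ x y, gradSq ψ (x, y) =
      ((deriv χ (x / ρ) / ρ) * w (y * k (x / ρ) / ε) +
        χ (x / ρ) * (deriv w (y * k (x / ρ) / ε) * (y * (s * deriv v (x / ρ) / ρ) / ε))) ^ 2 +
      (χ (x / ρ) * (deriv w (y * k (x / ρ) / ε) * (k (x / ρ) / ε))) ^ 2 := by
    intro x y
    have d0 : HasDerivAt (fun x : ℝ => x / ρ) (1 / ρ) x := (hasDerivAt_id x).div_const ρ
    have dχ : HasDerivAt (fun x => χ (x / ρ)) (deriv χ (x / ρ) / ρ) x := by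
      have := ((hχ.differentiable (by simp) (x / ρ)).hasDerivAt).comp x d0
      refine this.congr_deriv ?_; ring
    have dk : HasDerivAt (fun x => y * k (x / ρ) / ε) (y * (s * deriv v (x / ρ) / ρ) / ε) x := by
      have := ((((hkD (x / ρ)).comp x d0).const_mul y).div_const ε)
      refine this.congr_deriv ?_; ring
    have dw := ((hw.differentiable (by simp) (y * k (x / ρ) / ε)).hasDerivAt).comp x dk
    have e1 : HasDerivAt (fun x => ψ (x, y)) ((deriv χ (x / ρ) / ρ) * w (y * k (x / ρ) / ε) +
        χ (x / ρ) * (deriv w (y * k (x / ρ) / ε) * (y * (s * deriv v (x / ρ) / ρ) / ε))) x := by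
      rw [hψdef]; exact dχ.mul dw
    have dy : HasDerivAt (fun y => y * k (x / ρ) / ε) (k (x / ρ) / ε) y := by
      have := ((hasDerivAt_id y).mul_const (k (x / ρ))).div_const ε
      refine this.congr_deriv ?_; ring
    have dw2 := ((hw.differentiable (by simp) (y * k (x / ρ) / ε)).hasDerivAt).comp y dy
    have e2 : HasDerivAt (fun y => ψ (x, y)) (χ (x / ρ) * (deriv w (y * k (x / ρ) / ε) * (k (x / ρ) / ε))) y := by
      rw [hψdef]; exact dw2.const_mul (χ (x / ρ))
    unfold gradSq
    simp only
    rw [e1.deriv, e2.deriv]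
  have hσ1 : ∀ σ, σ ^ 2 * deriv w σ ^ 2 ≤ deriv w σ ^ 2 := by
    intro σ
    by_cases h0 : deriv w σ = 0
    · simp [h0]
    have h1 : σ ∈ Icc s1 s2 := closure_minimal (fun x hx => hws x hx) isClosed_Icc (support_deriv_subset h0)
    have : σ ^ 2 ≤ 1 := by
      apply pow_le_one₀ (hs1.le.trans h1.1) (h1.2.trans hs2.le)
    exact mul_le_of_le_one_left (sq_nonneg _) this
  have iw : Integrable (fun σ => w σ ^ 2) := by
    simpa [sq] using ns_sq_int volume w w hw.continuous hw.continuous hwcs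
  have cdw : Continuous (deriv w) := hw.continuous_deriv (by simp)
  have idw : Integrable (fun σ => deriv w σ ^ 2) := by
    simpa [sq] using ns_sq_int volume (deriv w) (deriv w) cdw cdw hwcs.deriv
  have iχ : Integrable (fun t => χ t ^ 2) := by
    simpa [sq] using ns_sq_int volume χ χ hχ.continuous hχ.continuous hχs
  have cdχ : Continuous (deriv χ) := hχ.continuous_deriv (by simp)
  have iχ' : Integrable (fun t => deriv χ t ^ 2 + q t * χ t ^ 2) := by
    have := (ns_sq_int volume (deriv χ) (deriv χ) cdχ cdχ hχs.deriv).add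
      (ns_sq_int volume χ (fun t => χ t * q t) hχ.continuous (hχ.continuous.mul hqc) hχs)
    refine this.congr (Eventually.of_forall fun t => ?_)
    simp only [Pi.add_apply]; ring
  obtain ⟨F1, G1⟩ := ns_fubini _ (ns_grad_int ψ hψ hψs)
  have iψ : Integrable (fun p => ψ p ^ 2) := by
    simpa [sq] using ns_sq_int volume ψ ψ hψ.continuous hψ.continuous hψs
  obtain ⟨F2, G2⟩ := ns_fubini _ iψ
  -- inner mass
  have hN : ∀ x, x / ρ ∈ Icc (-R) R → ∫ y, ψ (x, y) ^ 2 = ε * (k (x / ρ))⁻¹ * W0 * χ (x / ρ) ^ 2 := by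
    intro x hx
    have hc : 0 < k (x / ρ) := hkp _ hx
    have e : ∀ y, ψ (x, y) ^ 2 = χ (x / ρ) ^ 2 * (fun σ => w σ ^ 2) ((k (x / ρ) / ε) * y) := by
      intro y; rw [hψdef]; simp only [mul_pow]
      rw [show y * (1 / M + s * v (x / ρ)) / ε = k (x / ρ) / ε * y by simp only [hk]; ring]
    simp_rw [e]
    rw [integral_const_mul, Measure.integral_comp_mul_left (fun σ => w σ ^ 2), abs_of_pos (by positivity), smul_eq_mul, ← hW0d]
    rw [inv_div]; ring
  have hN0 : ∀ x, x / ρ ∉ Icc (-R) R → ∫ y, ψ (x, y) ^ 2 = 0 := by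
    intro x hx
    rw [hψdef]; simp [(hχ0 _ hx).1]
  have hE : ∀ x, ∫ y, gradSq ψ (x, y) ≤ π ^ 2 / (M ^ 2 * ε ^ 2) * (∫ y, ψ (x, y) ^ 2) +
      ε * W0 * M / ρ ^ 2 * ((1 + θ) * (deriv χ (x / ρ) ^ 2 + q (x / ρ) * χ (x / ρ) ^ 2) + 2 * θ * χ (x / ρ) ^ 2) := by
    intro x
    by_cases hx : x / ρ ∈ Icc (-R) R
    swap
    · rw [hN0 x hx]
      simp_rw [hgrad]
      simp [(hχ0 _ hx).1, (hχ0 _ hx).2]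
    rw [hN x hx]
    set t := x / ρ with ht
    have hc : 0 < k t := hkp _ hx
    set A : ℝ := (1 + θ) * (deriv χ t / ρ) ^ 2 with hA
    set B : ℝ := (1 + 1 / θ) * χ t ^ 2 * (s * deriv v t / k t) ^ 2 / ρ ^ 2 + χ t ^ 2 * (k t / ε) ^ 2 with hB
    have hB0 : 0 ≤ B := by positivity
    have b1 : ∀ y, gradSq ψ (x, y) ≤ A * (fun σ => w σ ^ 2) ((k t / ε) * y) + B * (fun σ => deriv w σ ^ 2) ((k t / ε) * y) := by
      intro y
      rw [hgrad, ← ht]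
      set σ := k t / ε * y with hσ
      have e1 : y * k t / ε = σ := by rw [hσ]; ring
      have e2 : y * (s * deriv v t / ρ) / ε = σ * (s * deriv v t / k t) / ρ := by
        rw [hσ]; field_simp
      rw [e1, e2]
      have young : ∀ P Q : ℝ, (P + Q) ^ 2 ≤ (1 + θ) * P ^ 2 + (1 + 1 / θ) * Q ^ 2 := by
        intro P Q
        have : 0 ≤ (θ * P - Q) ^ 2 / θ := by positivity
        have e : (θ * P - Q) ^ 2 / θ = θ * P ^ 2 - 2 * P * Q + 1 / θ * Q ^ 2 := by field_simp; ring
        nlinarith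
      have y1 := young (deriv χ t / ρ * w σ) (χ t * (deriv w σ * (σ * (s * deriv v t / k t) / ρ)))
      have y2 : (1 + 1 / θ) * (χ t * (deriv w σ * (σ * (s * deriv v t / k t) / ρ))) ^ 2 ≤
          (1 + 1 / θ) * χ t ^ 2 * (s * deriv v t / k t) ^ 2 / ρ ^ 2 * deriv w σ ^ 2 := by
        have h0 : 0 ≤ (1 + 1 / θ) * χ t ^ 2 * (s * deriv v t / k t) ^ 2 / ρ ^ 2 := by positivity
        have := mul_le_mul_of_nonneg_left (hσ1 σ) h0
        refine le_trans (le_of_eq ?_) this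
        ring
      simp only
      rw [hA, hB]
      nlinarith
    have i1 : Integrable (fun y => A * (fun σ => w σ ^ 2) ((k t / ε) * y)) :=
      (iw.comp_mul_left' (by positivity)).const_mul A
    have i2 : Integrable (fun y => B * (fun σ => deriv w σ ^ 2) ((k t / ε) * y)) :=
      (idw.comp_mul_left' (by positivity)).const_mul B
    have b2 : ∫ y, gradSq ψ (x, y) ≤ ∫ y, (A * (fun σ => w σ ^ 2) ((k t / ε) * y) + B * (fun σ => deriv w σ ^ 2) ((k t / ε) * y)) := by
      apply integral_mono_of_nonneg
      · exact Eventually.of_forall fun y => add_nonneg (sq_nonneg _) (sq_nonneg _)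
      · exact i1.add i2
      · exact Eventually.of_forall b1
    rw [integral_add i1 i2, integral_const_mul, integral_const_mul, Measure.integral_comp_mul_left (fun σ => w σ ^ 2),
      Measure.integral_comp_mul_left (fun σ => deriv w σ ^ 2), abs_of_pos (by positivity), smul_eq_mul, smul_eq_mul, ← hW0d, inv_div] at b2
    have hkc : 0 < ε / k t := by positivity
    have b3 : B * (ε / k t * ∫ σ, deriv w σ ^ 2) ≤ B * (ε / k t * ((π ^ 2 + κ) * W0)) := by
      gcongr
    have b4 : A + B * (π ^ 2 + κ) ≤ π ^ 2 / (M ^ 2 * ε ^ 2) * χ t ^ 2 +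
        1 / ρ ^ 2 * ((1 + θ) * (deriv χ t ^ 2 + q t * χ t ^ 2) + 2 * θ * χ t ^ 2) := by
      have h1 := hbr t hx
      change (1 + 1 / θ) * (s * deriv v t / k t) ^ 2 * (π ^ 2 + κ) +
        ((k t) ^ 2 * (π ^ 2 + κ) - π ^ 2 / M ^ 2) / s ≤ q t + 2 * θ at h1
      have h2 : 0 ≤ χ t ^ 2 / ρ ^ 2 := by positivity
      have h3 := mul_le_mul_of_nonneg_left h1 h2
      have h4 : 0 ≤ θ * q t * (χ t ^ 2 / ρ ^ 2) := mul_nonneg (mul_nonneg hθ.le (hq0 t)) h2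
      have h5 : A + B * (π ^ 2 + κ) = π ^ 2 / (M ^ 2 * ε ^ 2) * χ t ^ 2 + (1 + θ) * deriv χ t ^ 2 / ρ ^ 2 +
        χ t ^ 2 / ρ ^ 2 * ((1 + 1 / θ) * (s * deriv v t / k t) ^ 2 * (π ^ 2 + κ) +
        ((k t) ^ 2 * (π ^ 2 + κ) - π ^ 2 / M ^ 2) / s) := by
        rw [hA, hB, div_pow (k t) ε 2, ← hsρ]
        field_simp
        ring
      rw [h5]
      have h6 : χ t ^ 2 / ρ ^ 2 * (q t + 2 * θ) + θ * q t * (χ t ^ 2 / ρ ^ 2) = 1 / ρ ^ 2 * ((1 + θ) * (q t * χ t ^ 2) + 2 * θ * χ t ^ 2) := by ring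
      have h7 : (1 + θ) * deriv χ t ^ 2 / ρ ^ 2 = 1 / ρ ^ 2 * ((1 + θ) * deriv χ t ^ 2) := by ring
      rw [h7]
      linarith
    have b5 : A * (ε / k t * W0) + B * (ε / k t * ((π ^ 2 + κ) * W0)) ≤ (ε / k t * W0) * (π ^ 2 / (M ^ 2 * ε ^ 2) * χ t ^ 2 +
        1 / ρ ^ 2 * ((1 + θ) * (deriv χ t ^ 2 + q t * χ t ^ 2) + 2 * θ * χ t ^ 2)) := by
      have := mul_le_mul_of_nonneg_left b4 (by positivity : 0 ≤ ε / k t * W0)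
      linarith
    have b6 : (ε / k t * W0) * (1 / ρ ^ 2 * ((1 + θ) * (deriv χ t ^ 2 + q t * χ t ^ 2) + 2 * θ * χ t ^ 2)) ≤
        ε * W0 * M / ρ ^ 2 * ((1 + θ) * (deriv χ t ^ 2 + q t * χ t ^ 2) + 2 * θ * χ t ^ 2) := by
      have h1 : 0 ≤ ((1 + θ) * (deriv χ t ^ 2 + q t * χ t ^ 2) + 2 * θ * χ t ^ 2) := by
        have := hq0 t
        positivity
      have h2 : ε / k t * W0 * (1 / ρ ^ 2) ≤ ε * W0 * M / ρ ^ 2 := by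
        have := mul_le_mul_of_nonneg_left (hkinv t hx).1 (by positivity : 0 ≤ ε * W0 / ρ ^ 2)
        calc _ = ε * W0 / ρ ^ 2 * (k t)⁻¹ := by rw [div_eq_mul_inv ε]; ring
          _ ≤ _ := this
          _ = _ := by ring
      have := mul_le_mul_of_nonneg_right h2 h1
      linarith
    have e7 : π ^ 2 / (M ^ 2 * ε ^ 2) * (ε * (k t)⁻¹ * W0 * χ t ^ 2) = (ε / k t * W0) * (π ^ 2 / (M ^ 2 * ε ^ 2) * χ t ^ 2) := by
      rw [div_eq_mul_inv ε]; ring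
    rw [e7]
    linarith
  have hNlow : ∀ x, ε * W0 * M / (1 + θ) * χ (x / ρ) ^ 2 ≤ ∫ y, ψ (x, y) ^ 2 := by
    intro x
    by_cases hx : x / ρ ∈ Icc (-R) R
    · rw [hN x hx]
      have := mul_le_mul_of_nonneg_left (hkinv _ hx).2 (by positivity : 0 ≤ ε * W0 * χ (x / ρ) ^ 2)
      calc _ = ε * W0 * χ (x / ρ) ^ 2 * (M / (1 + θ)) := by ring
        _ ≤ _ := this
        _ = _ := by ring
    · rw [hN0 x hx, (hχ0 _ hx).1]; simp
  have hρ' : ρ ≠ 0 := hρ.ne'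
  have iS : Integrable (fun x => (1 + θ) * (deriv χ (x / ρ) ^ 2 + q (x / ρ) * χ (x / ρ) ^ 2) + 2 * θ * χ (x / ρ) ^ 2) :=
    ((iχ'.comp_div hρ').const_mul _).add ((iχ.comp_div hρ').const_mul _)
  have c1 : ∫ x, ∫ y, gradSq ψ (x, y) ≤ ∫ x, (π ^ 2 / (M ^ 2 * ε ^ 2) * (∫ y, ψ (x, y) ^ 2) +
      ε * W0 * M / ρ ^ 2 * ((1 + θ) * (deriv χ (x / ρ) ^ 2 + q (x / ρ) * χ (x / ρ) ^ 2) + 2 * θ * χ (x / ρ) ^ 2)) :=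
    integral_mono G1 ((G2.const_mul _).add (iS.const_mul _)) hE
  rw [integral_add (G2.const_mul _) (iS.const_mul _), integral_const_mul, integral_const_mul,
    integral_add ((iχ'.comp_div hρ').const_mul _) ((iχ.comp_div hρ').const_mul _), integral_const_mul, integral_const_mul,
    Measure.integral_comp_div (fun t => deriv χ t ^ 2 + q t * χ t ^ 2), Measure.integral_comp_div (fun t => χ t ^ 2),
    abs_of_pos hρ, smul_eq_mul, smul_eq_mul, ← F1, ← F2] at c1
  have c2 : ∫ x, ε * W0 * M / (1 + θ) * χ (x / ρ) ^ 2 ≤ ∫ x, ∫ y, ψ (x, y) ^ 2 :=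
    integral_mono ((iχ.comp_div hρ').const_mul _) G2 hNlow
  rw [integral_const_mul, Measure.integral_comp_div (fun t => χ t ^ 2), abs_of_pos hρ, smul_eq_mul, ← F2] at c2
  set X := ∫ t, χ t ^ 2 with hX
  set Y := ∫ t, (deriv χ t ^ 2 + q t * χ t ^ 2)
  set N := ∫ p, ψ p ^ 2
  have d1 : ε * W0 * M / ρ ^ 2 * ((1 + θ) * (ρ * Y) + 2 * θ * (ρ * X)) ≤ ε * W0 * M / ρ ^ 2 * ((1 + θ) * (ρ * (ν * X)) + 2 * θ * (ρ * X)) := by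
    gcongr
  have d2 := mul_le_mul_of_nonneg_left c2 (by positivity : 0 ≤ (1 + θ) * ((1 + θ) * ν + 2 * θ) / ρ ^ 2)
  have d3 : (1 + θ) * ((1 + θ) * ν + 2 * θ) / ρ ^ 2 * (ε * W0 * M / (1 + θ) * (ρ * X)) =
      ε * W0 * M / ρ ^ 2 * ((1 + θ) * (ρ * (ν * X)) + 2 * θ * (ρ * X)) := by
    field_simp
  rw [add_mul]
  linarith

set_option maxHeartbeats 2000000 in
lemma ns_upper_fin (h q : ℝ → ℝ) (a b M m K η : ℝ) (hM : 0 < M) (hm : 1 ≤ m) (ha : 0 < a) (hb : 0 < b)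
    (hη : 0 < η) (hqc : Continuous q) (hq0 : ∀ x, 0 ≤ q x)
    (hqs : ∀ ρ t, 0 < ρ → q (ρ * t) = ρ ^ m * q t)
    (hK : 0 < K)
    (hlow : ∀ x, |x| ≤ η → M - M ^ 3 / (2 * π ^ 2) * q x - K * |x| ^ (m + 1) ≤ h x)
    (j : ℕ) (hj : 1 ≤ j) (τ : ℝ) (hτ : schroedingerMinMax q j < τ) :
    ∃ r > 0, ∀ ε ρ s : ℝ, 0 < ε → 0 < ρ → ρ < r → 0 < s → s < r → s = ρ ^ m → s * ρ ^ 2 = ε ^ 2 →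
      ∃ F : Submodule ℝ ((ℝ × ℝ) → ℝ), Module.finrank ℝ F = j ∧
      (∀ ψ ∈ F, ContDiff ℝ (⊤ : ℕ∞) ψ ∧ HasCompactSupport ψ ∧
        tsupport ψ ⊆ {p : ℝ × ℝ | p.1 ∈ Icc (-a) b ∧ 0 < p.2 ∧ p.2 < ε * h p.1}) ∧
      ∀ ψ ∈ F, ∫ p, gradSq ψ p ≤ (π ^ 2 / (M ^ 2 * ε ^ 2) + τ / ρ ^ 2) * ∫ p, ψ p ^ 2 := by
  set μ := schroedingerMinMax q j with hμ
  have hμ0 : 0 ≤ μ := ns_sch_nonneg q hq0 j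
  obtain ⟨θ, hθτ, hθ1, hθ⟩ : ∃ θ : ℝ, (1 + θ) * ((1 + θ) * (μ + θ) + 2 * θ) < τ ∧ θ < 1 ∧ 0 < θ := by
    have c : Continuous (fun θ : ℝ => (1 + θ) * ((1 + θ) * (μ + θ) + 2 * θ)) := by fun_prop
    have t : Tendsto (fun θ : ℝ => (1 + θ) * ((1 + θ) * (μ + θ) + 2 * θ)) (nhdsWithin 0 (Ioi 0)) (nhds μ) := by
      have := (c.tendsto 0).mono_left (nhdsWithin_le_nhds (s := Ioi 0))
      simpa using this
    have e1 : ∀ᶠ θ in nhdsWithin (0:ℝ) (Ioi 0), θ < 1 := mem_nhdsWithin_of_mem_nhds (Iio_mem_nhds one_pos)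
    have e2 : ∀ᶠ θ in nhdsWithin (0:ℝ) (Ioi 0), 0 < θ := self_mem_nhdsWithin
    have e := (t.eventually_lt_const hτ).and (e1.and e2)
    exact e.exists
  obtain ⟨F, hF1, hF2, hF3⟩ := ns_sch_upper q hq0 hqc j hj θ hθ
  obtain ⟨hfd, -⟩ := ns_finrank_ne F j hj hF1
  obtain ⟨R, hR0, hR⟩ := ns_common_supp F (fun χ hχ => (hF2 χ hχ).2)
  set δ := θ * M / (8 * π ^ 2) with hδ
  have hδ0 : 0 < δ := by positivity
  obtain ⟨p, hp⟩ := exists_polynomial_near_of_continuousOn (-R) R (fun t => q t * M / (2 * π ^ 2) + 3 * δ)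
    (by fun_prop) δ hδ0
  set v : ℝ → ℝ := fun t => p.eval t with hv
  have hvC : ContDiff ℝ (⊤ : ℕ∞) v := by
    have := p.contDiff_aeval (𝕜 := ℝ) (⊤ : ℕ∞)
    simpa [hv, Polynomial.coe_aeval_eq_eval] using this
  have hv1 : ∀ t ∈ Icc (-R) R, q t * M / (2 * π ^ 2) + 2 * δ ≤ v t ∧ v t ≤ q t * M / (2 * π ^ 2) + 4 * δ := by
    intro t ht
    have := abs_lt.1 (hp t ht)
    constructor <;> simp only [hv] <;> linarith [this.1, this.2]
  have hv0 : ∀ t ∈ Icc (-R) R, 0 ≤ v t := fun t ht => by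
    have := (hv1 t ht).1
    have h2 : 0 ≤ q t * M / (2 * π ^ 2) := by have := hq0 t; positivity
    linarith
  obtain ⟨V1, hV1⟩ := isCompact_Icc.exists_bound_of_continuousOn (hvC.continuous.continuousOn (s := Icc (-R) R))
  obtain ⟨V2, hV2⟩ := isCompact_Icc.exists_bound_of_continuousOn ((hvC.continuous_deriv (by simp)).continuousOn (s := Icc (-R) R))
  set V := max V1 V2
  have hVv : ∀ t ∈ Icc (-R) R, |v t| ≤ V := fun t ht => (hV1 t ht).trans (le_max_left _ _)
  have hVd : ∀ t ∈ Icc (-R) R, |deriv v t| ≤ V := fun t ht => (hV2 t ht).trans (le_max_right _ _)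
  have hV0 : 0 ≤ V := (abs_nonneg _).trans (hVv 0 ⟨by linarith, hR0.le⟩)
  have small : ∀ (f : ℝ → ℝ) (c : ℝ), Continuous f → f 0 = 0 → 0 < c → ∀ᶠ x in nhdsWithin (0:ℝ) (Ioi 0), f x ≤ c := by
    intro f c hf h0 hc
    have := (hf.tendsto 0).mono_left (nhdsWithin_le_nhds (s := Ioi 0))
    rw [h0] at this
    exact (this.eventually_lt_const hc).mono fun _ h => h.le
  have ev : ∀ᶠ x in nhdsWithin (0:ℝ) (Ioi 0), (x * R ≤ a ∧ x * R ≤ b ∧ x * R ≤ η) ∧ K * x * R ^ (m + 1) ≤ δ * M ^ 2 ∧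
      x * V ≤ θ / M ∧ (1 + 1 / θ) * (x * V * M) ^ 2 * (π ^ 2 + x * θ * M ^ 2 / 16) ≤ θ / 4 ∧
      π ^ 2 * x * V ^ 2 ≤ θ / 4 ∧ x * M * V ^ 2 ≤ δ := by
    refine ((small _ _ (by fun_prop) (by simp) ha).and ((small _ _ (by fun_prop) (by simp) hb).and (small _ _ (by fun_prop) (by simp) hη))).and ?_
    refine (small _ _ (by fun_prop) (by simp) (by positivity)).and ?_
    refine (small _ _ (by fun_prop) (by simp) (by positivity)).and ?_
    refine (small _ _ (by fun_prop) (by simp) (by positivity)).and ?_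
    exact (small _ _ (by fun_prop) (by simp) (by positivity)).and (small _ _ (by fun_prop) (by simp) (by positivity))
  obtain ⟨r, hr0, hr⟩ := mem_nhdsGT_iff_exists_Ioo_subset.1 ev
  refine ⟨r, hr0, ?_⟩
  intro ε ρ s hε hρ hρr hs hsr hsm hsρ
  obtain ⟨⟨r1, r2, r3⟩, r4, -⟩ := hr (show ρ ∈ Ioo 0 r from ⟨hρ, hρr⟩)
  obtain ⟨-, -, r5, r6, r7, r8⟩ := hr (show s ∈ Ioo 0 r from ⟨hs, hsr⟩)
  set κ := s * θ * M ^ 2 / 16 with hκd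
  have hκ : 0 < κ := by positivity
  obtain ⟨w, hw, ⟨s1, s2, hs1, hs2, hws⟩, hW0, hW1⟩ := ns_exists_w κ hκ
  set k : ℝ → ℝ := fun t => 1 / M + s * v t with hk
  have hkC : ContDiff ℝ (⊤ : ℕ∞) k := contDiff_const.add (contDiff_const.mul hvC)
  have hk1 : ∀ t ∈ Icc (-R) R, 1 / M ≤ k t := fun t ht => by
    have := mul_nonneg hs.le (hv0 t ht)
    simp only [hk]; linarith
  have hk2 : ∀ t ∈ Icc (-R) R, k t ≤ (1 + θ) / M := fun t ht => by
    have h1 : s * v t ≤ s * V := mul_le_mul_of_nonneg_left ((le_abs_self _).trans (hVv t ht)) hs.le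
    simp only [hk]
    rw [add_div]
    linarith
  have hvle : ∀ t ∈ Icc (-R) R, v t ^ 2 ≤ V ^ 2 := fun t ht => sq_le_sq' (abs_le.1 (hVv t ht)).1 (abs_le.1 (hVv t ht)).2
  have hbr : ∀ t ∈ Icc (-R) R, (1 + 1 / θ) * (s * deriv v t / (1 / M + s * v t)) ^ 2 * (π ^ 2 + κ) +
      ((1 / M + s * v t) ^ 2 * (π ^ 2 + κ) - π ^ 2 / M ^ 2) / s ≤ q t + 2 * θ := by
    intro t ht
    have g1 : |s * deriv v t / (1 / M + s * v t)| ≤ s * V * M := by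
      rw [abs_div, abs_mul, abs_of_pos hs]
      have h0 : 0 < k t := lt_of_lt_of_le (by positivity) (hk1 t ht)
      have h1 : 1 / M ≤ 1 / M + s * v t := hk1 t ht
      rw [abs_of_pos (show 0 < 1 / M + s * v t from h0), div_le_iff₀ (show 0 < 1 / M + s * v t from h0)]
      calc s * |deriv v t| ≤ s * V := mul_le_mul_of_nonneg_left (hVd t ht) hs.le
        _ = s * V * M * (1 / M) := by field_simp
        _ ≤ _ := mul_le_mul_of_nonneg_left h1 (by positivity)
    have g2 : (s * deriv v t / (1 / M + s * v t)) ^ 2 ≤ (s * V * M) ^ 2 := sq_le_sq' (abs_le.1 g1).1 (abs_le.1 g1).2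
    have g3 : (1 + 1 / θ) * (s * deriv v t / (1 / M + s * v t)) ^ 2 * (π ^ 2 + κ) ≤ θ / 4 := by
      refine le_trans ?_ r6
      gcongr
    have g4 : ((1 / M + s * v t) ^ 2 * (π ^ 2 + κ) - π ^ 2 / M ^ 2) / s = 2 * π ^ 2 / M * v t + π ^ 2 * s * v t ^ 2 + (k t) ^ 2 * (κ / s) := by
      simp only [hk]
      field_simp
      ring
    have g5 : (k t) ^ 2 * (κ / s) ≤ θ / 4 := by
      have h0 : 0 < k t := lt_of_lt_of_le (by positivity) (hk1 t ht)
      have h1 : k t ≤ 2 / M := (hk2 t ht).trans (by gcongr; linarith)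
      have h2 : κ / s = θ * M ^ 2 / 16 := by rw [hκd]; field_simp
      rw [h2]
      calc (k t) ^ 2 * (θ * M ^ 2 / 16) ≤ (2 / M) ^ 2 * (θ * M ^ 2 / 16) := by gcongr
        _ = θ / 4 := by field_simp; norm_num
    have g6 : π ^ 2 * s * v t ^ 2 ≤ θ / 4 := le_trans (mul_le_mul_of_nonneg_left (hvle t ht) (by positivity)) r7
    have g7 : 2 * π ^ 2 / M * v t ≤ q t + θ := by
      have := mul_le_mul_of_nonneg_left (hv1 t ht).2 (by positivity : 0 ≤ 2 * π ^ 2 / M)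
      refine this.trans (le_of_eq ?_)
      rw [hδ]; field_simp; ring
    rw [g4]
    linarith
  have hΩ : ∀ x y, x / ρ ∈ Icc (-R) R → 0 < y → y * k (x / ρ) < ε →
      (x, y) ∈ {p : ℝ × ℝ | p.1 ∈ Icc (-a) b ∧ 0 < p.2 ∧ p.2 < ε * h p.1} := by
    intro x y hx hy hyk
    set t := x / ρ with ht
    have hxt : x = ρ * t := by rw [ht]; field_simp
    have hta : |t| ≤ R := abs_le.2 hx
    have hxa : |x| ≤ ρ * R := by
      rw [hxt, abs_mul, abs_of_pos hρ]; exact mul_le_mul_of_nonneg_left hta hρ.le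
    have hxI := abs_le.1 hxa
    refine ⟨⟨by linarith, by linarith⟩, hy, ?_⟩
    simp only
    have hh := hlow x (hxa.trans r3)
    have e1 : |x| ^ (m + 1) = s * ρ * |t| ^ (m + 1) := by
      rw [hxt, abs_mul, abs_of_pos hρ, mul_rpow hρ.le (abs_nonneg _), rpow_add hρ, rpow_one, hsm]
    have e2 : |t| ^ (m + 1) ≤ R ^ (m + 1) := rpow_le_rpow (abs_nonneg _) hta (by linarith)
    have e3 : K * |x| ^ (m + 1) ≤ s * (δ * M ^ 2) := by
      rw [e1]
      calc K * (s * ρ * |t| ^ (m + 1)) ≤ K * (s * ρ * R ^ (m + 1)) := by gcongr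
        _ = s * (K * ρ * R ^ (m + 1)) := by ring
        _ ≤ _ := mul_le_mul_of_nonneg_left r4 hs.le
    have e4 : q x = s * q t := by rw [hxt, hqs ρ t hρ, hsm]
    rw [e4] at hh
    have e5 : M ^ 3 / (2 * π ^ 2) * (s * q t) ≤ s * M ^ 2 * (v t - 2 * δ) := by
      have : q t * M / (2 * π ^ 2) ≤ v t - 2 * δ := by linarith [(hv1 t hx).1]
      calc M ^ 3 / (2 * π ^ 2) * (s * q t) = s * M ^ 2 * (q t * M / (2 * π ^ 2)) := by ring
        _ ≤ _ := mul_le_mul_of_nonneg_left this (by positivity)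
    have e6 : M - s * M ^ 2 * (v t - δ) ≤ h x := by
      have e60 : s * M ^ 2 * (v t - 2 * δ) + s * (δ * M ^ 2) = s * M ^ 2 * (v t - δ) := by ring
      linarith only [e60, e5, e3, hh]
    have kp : 0 < k t := lt_of_lt_of_le (by positivity) (hk1 t hx)
    have e7 : 1 ≤ k t * h x := by
      refine le_trans ?_ (mul_le_mul_of_nonneg_left e6 kp.le)
      have e8 : k t * (M - s * M ^ 2 * (v t - δ)) = 1 + s * M * (δ - s * M * (v t * (v t - δ))) := by
        simp only [hk]; field_simp; ring
      rw [e8]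
      have e9 : v t * (v t - δ) ≤ V ^ 2 := by
        have := mul_nonneg (hv0 t hx) hδ0.le
        nlinarith [hvle t hx]
      have e10 : s * M * (v t * (v t - δ)) ≤ s * M * V ^ 2 := mul_le_mul_of_nonneg_left e9 (by positivity)
      have : 0 ≤ s * M * (δ - s * M * (v t * (v t - δ))) := mul_nonneg (by positivity) (by linarith)
      linarith
    have e11 : y * k t < (ε * h x) * k t := by
      refine lt_of_lt_of_le hyk ?_
      have := mul_le_mul_of_nonneg_left e7 hε.le
      linarith
    exact lt_of_mul_lt_mul_right e11 kp.le
  let T : (ℝ → ℝ) →ₗ[ℝ] ((ℝ × ℝ) → ℝ) := {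
    toFun := fun χ p => χ (p.1 / ρ) * w (p.2 * k (p.1 / ρ) / ε)
    map_add' := by intro f g; ext p; simp; ring
    map_smul' := by intro c f; ext p; simp; ring }
  have hinj : Function.Injective (T.domRestrict F) := by
    rw [← LinearMap.ker_eq_bot, LinearMap.ker_eq_bot']
    intro χ hχ
    obtain ⟨σ, hσ⟩ : ∃ σ, w σ ≠ 0 := by
      by_contra hcon
      push Not at hcon
      simp [hcon] at hW0
    ext t
    by_cases ht : t ∈ Icc (-R) R
    · have kp : 0 < k t := lt_of_lt_of_le (by positivity) (hk1 t ht)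
      have h1 : χ.1 (ρ * t / ρ) * w (ε * σ / k t * k (ρ * t / ρ) / ε) = 0 := congrFun hχ (ρ * t, ε * σ / k t)
      rw [mul_div_cancel_left₀ _ hρ.ne', div_mul_cancel₀ _ kp.ne', mul_div_cancel_left₀ _ hε.ne'] at h1
      exact (mul_eq_zero.1 h1).resolve_right hσ
    · by_contra hne
      exact ht (hR χ.1 χ.2 (subset_tsupport _ hne))
  refine ⟨LinearMap.range (T.domRestrict F), ?_, ?_, ?_⟩
  · rw [LinearMap.finrank_range_of_inj hinj, hF1]
  · rintro ψ ⟨χ, rfl⟩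
    exact ns_trial_reg _ ε ρ R M hε hρ k w χ.1 hkC hw (hF2 χ.1 χ.2).1 s1 s2 hs1 hs2 hws (hR χ.1 χ.2) hM hk1 hΩ
  · rintro ψ ⟨χ, rfl⟩
    obtain ⟨t1, t2, t3⟩ := ns_trial_reg _ ε ρ R M hε hρ k w χ.1 hkC hw (hF2 χ.1 χ.2).1 s1 s2 hs1 hs2 hws (hR χ.1 χ.2) hM hk1 hΩ
    have := ns_trial_energy ε ρ R M s θ κ hκ hε hρ hs hθ hsρ v w χ.1 q hvC hw (hF2 χ.1 χ.2).1 (hF2 χ.1 χ.2).2 hqc hq0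
      s1 s2 hs1 hs2 hws hW0 hW1 (hR χ.1 χ.2) hM hk1 hk2 hbr (μ + θ) (by positivity) (hF3 χ.1 χ.2) _ rfl t1 t2
    refine this.trans ?_
    apply mul_le_mul_of_nonneg_right _ (integral_nonneg fun p => sq_nonneg _)
    gcongr

lemma ns_int_Ioo (g : ℝ → ℝ) (L : ℝ) (hL : 0 ≤ L) (hg : ∀ y, ¬ (0 < y ∧ y < L) → g y = 0) :
    ∫ y, g y = ∫ y in (0:ℝ)..L, g y := by
  rw [intervalIntegral.integral_of_le hL]
  symm
  apply setIntegral_eq_integral_of_forall_compl_eq_zero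
  intro y hy
  apply hg
  intro h
  exact hy ⟨h.1, h.2.le⟩

lemma ns_slice (h : ℝ → ℝ) (a b M ε L κ : ℝ) (hM : 0 < M) (hε : 0 < ε) (hL : L = ε * M) (hκ : κ = π / L)
    (hpos : ∀ x ∈ Icc (-a) b, 0 < h x) (hle : ∀ x ∈ Icc (-a) b, h x ≤ M)
    (ψ : ℝ × ℝ → ℝ) (hψ : ContDiff ℝ (⊤ : ℕ∞) ψ) (hs : HasCompactSupport ψ)
    (ht : tsupport ψ ⊆ {p : ℝ × ℝ | p.1 ∈ Icc (-a) b ∧ 0 < p.2 ∧ p.2 < ε * h p.1})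
    (x : ℝ) :
    (∫ y, fderiv ℝ ψ (x, y) (1, 0) * (√(2 / L) * sin (π / L * y))) ^ 2 ≤ ∫ y, (fderiv ℝ ψ (x, y) (1, 0)) ^ 2 ∧
    (∫ y, ψ (x, y) * (√(2 / L) * sin (π / L * y))) ^ 2 ≤ ∫ y, ψ (x, y) ^ 2 ∧
    3 * κ ^ 2 * ((∫ y, ψ (x, y) ^ 2) - (∫ y, ψ (x, y) * (√(2 / L) * sin (π / L * y))) ^ 2) ≤
      (∫ y, (fderiv ℝ ψ (x, y) (0, 1)) ^ 2) - κ ^ 2 * ∫ y, ψ (x, y) ^ 2 ∧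
    (x ∈ Icc (-a) b → (π / (ε * h x)) ^ 2 * (∫ y, ψ (x, y) ^ 2) ≤ ∫ y, (fderiv ℝ ψ (x, y) (0, 1)) ^ 2) ∧
    (x ∉ Icc (-a) b → (∫ y, ψ (x, y) ^ 2) = 0) := by
  have hL0 : 0 < L := by rw [hL]; positivity
  have z1 : ∀ x y, ¬ (x ∈ Icc (-a) b ∧ 0 < y ∧ y < ε * h x) → ψ (x, y) = 0 := by
    intro x y hn
    by_contra hne
    exact hn (ht (subset_tsupport _ hne))
  have z2 : ∀ v x y, ¬ (x ∈ Icc (-a) b ∧ 0 < y ∧ y < ε * h x) → fderiv ℝ ψ (x, y) v = 0 := by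
    intro v x y hn
    by_contra hne
    exact hn (ht (ns_fd_supp ψ v (subset_tsupport _ hne)))
  have inc : ∀ x y, ¬ (0 < y ∧ y < L) → ¬ (x ∈ Icc (-a) b ∧ 0 < y ∧ y < ε * h x) := by
    rintro x y hn ⟨h1, h2, h3⟩
    apply hn
    refine ⟨h2, h3.trans_le ?_⟩
    rw [hL]; exact mul_le_mul_of_nonneg_left (hle x h1) hε.le
  have cψ : ContDiff ℝ 1 (fun y => ψ (x, y)) := (hψ.of_le (by simp)).comp (by fun_prop)
  have cv : ∀ v, Continuous (fun y => fderiv ℝ ψ (x, y) v) := fun v =>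
    (ns_fd_smooth ψ hψ v).continuous.comp (by fun_prop : Continuous fun y : ℝ => (x, y))
  have dy : ∀ y, deriv (fun y => ψ (x, y)) y = fderiv ℝ ψ (x, y) (0, 1) := fun y => (ns_hasDeriv_y ψ hψ x y).deriv
  have sq2 : √(2 / L) ^ 2 = 2 / L := sq_sqrt (by positivity)
  have key : ∀ g : ℝ → ℝ, (∀ y, ¬ (0 < y ∧ y < L) → g y = 0) →
      (∫ y, g y * (√(2 / L) * sin (π / L * y))) ^ 2 = (2 / L) * (∫ y in (0:ℝ)..L, g y * sin (π / L * y)) ^ 2 := by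
    intro g hg
    rw [ns_int_Ioo _ L hL0.le (fun y hy => by rw [hg y hy, zero_mul])]
    have : (fun y => g y * (√(2 / L) * sin (π / L * y))) = fun y => √(2 / L) * (g y * sin (π / L * y)) := by
      ext y; ring
    rw [this, intervalIntegral.integral_const_mul, mul_pow, sq2]
  have hz : ∀ y, ¬ (0 < y ∧ y < L) → ψ (x, y) = 0 := fun y hy => z1 x y (inc x y hy)
  have hzv : ∀ v y, ¬ (0 < y ∧ y < L) → fderiv ℝ ψ (x, y) v = 0 := fun v y hy => z2 v x y (inc x y hy)
  have N1 : ∫ y, ψ (x, y) ^ 2 = ∫ y in (0:ℝ)..L, ψ (x, y) ^ 2 :=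
    ns_int_Ioo _ L hL0.le (fun y hy => by rw [hz y hy]; simp)
  have D1 : ∀ v, ∫ y, (fderiv ℝ ψ (x, y) v) ^ 2 = ∫ y in (0:ℝ)..L, (fderiv ℝ ψ (x, y) v) ^ 2 := fun v =>
    ns_int_Ioo _ L hL0.le (fun y hy => by rw [hzv v y hy]; simp)
  refine ⟨?_, ?_, ?_, ?_, ?_⟩
  · rw [key _ (hzv (1, 0)), D1]
    exact ns_cs0 _ (cv _) L hL0
  · rw [key _ hz, N1]
    exact ns_cs0 _ cψ.continuous L hL0
  · rw [key _ hz, N1, D1, hκ]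
    have := ns_gap _ cψ L hL0 (hz 0 (by simp)) (hz L (by simp))
    simpa only [dy] using this
  · intro hx
    have hp : 0 < ε * h x := mul_pos hε (hpos x hx)
    have := ns_wirt _ cψ 0 (ε * h x) hp (z1 x 0 (by simp)) (z1 x _ (by simp))
    simp only [dy, sub_zero] at this
    rw [ns_int_Ioo (fun y => ψ (x, y) ^ 2) (ε * h x) hp.le (fun y hy => by rw [z1 x y (fun h => hy h.2)]; simp),
      ns_int_Ioo (fun y => (fderiv ℝ ψ (x, y) (0, 1)) ^ 2) (ε * h x) hp.le (fun y hy => by rw [z2 _ x y (fun h => hy h.2)]; simp)]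
    exact this
  · intro hx
    have : ∀ y, ψ (x, y) ^ 2 = 0 := fun y => by rw [z1 x y (fun h => hx h.1)]; simp
    simp [this]

lemma ns_W (H M ε : ℝ) (hM : 0 < M) (hε : 0 < ε) (hH : 0 < H) (hle : H ≤ M) :
    2 * π ^ 2 * (M - H) / M ^ 3 / ε ^ 2 ≤ (π / (ε * H)) ^ 2 - (π / (ε * M)) ^ 2 := by
  have e : (π / (ε * H)) ^ 2 - (π / (ε * M)) ^ 2 - 2 * π ^ 2 * (M - H) / M ^ 3 / ε ^ 2 =
      π ^ 2 * (M - H) ^ 2 * (M + 2 * H) / (ε ^ 2 * H ^ 2 * M ^ 3) := by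
    field_simp; ring
  have : 0 ≤ π ^ 2 * (M - H) ^ 2 * (M + 2 * H) / (ε ^ 2 * H ^ 2 * M ^ 3) := by positivity
  linarith

lemma ns_pt (θ γ c0 C ε2 κ W q c s f f' u' N Dx Dy κγ : ℝ) (hθ0 : 0 < θ) (hθ1 : θ < 1) (hε : 0 < ε2)
    (hcs : s ^ 2 + c ^ 2 = 1) (hu : u' ^ 2 ≤ C) (h1 : f' ^ 2 ≤ Dx) (h2 : f ^ 2 ≤ N)
    (h3 : 3 * κ ^ 2 * (N - f ^ 2) ≤ Dy - κ ^ 2 * N) (h4 : (W / ε2 + κ ^ 2) * N ≤ Dy)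
    (hq0 : 0 ≤ q) (hW : 0 ≤ W)
    (hW1 : (1 - θ) * q * c ^ 2 ≤ W * c ^ 2) (hW2 : c0 * s ^ 2 ≤ W * s ^ 2)
    (hγ1 : γ ≤ (1 - θ) * c0) (hγ2 : γ / ε2 ≤ 3 * θ * κ ^ 2) :
    (1 - θ) ^ 2 * ((f' * c + f * (-s * u')) ^ 2 + q / ε2 * (f * c) ^ 2) + γ / ε2 * (N - (f * c) ^ 2) - C * N
      ≤ Dx + Dy - κ ^ 2 * N := by
  have hD : 0 ≤ N - f ^ 2 := by linarith
  have C0 : 0 ≤ C := (sq_nonneg _).trans hu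
  have a1 : (f' * c + f * (-s * u')) ^ 2 ≤ f' ^ 2 + C * N := by
    have e : f' ^ 2 + u' ^ 2 * f ^ 2 - (f' * c + f * (-s * u')) ^ 2 = (f' * s + f * (c * u')) ^ 2 := by
      have : c ^ 2 = 1 - s ^ 2 := by linarith
      linear_combination (-(f' ^ 2 + u' ^ 2 * f ^ 2)) * hcs
    have e2 : u' ^ 2 * f ^ 2 ≤ C * N := mul_le_mul hu h2 (sq_nonneg _) C0
    nlinarith [sq_nonneg (f' * s + f * (c * u'))]
  have a2 : (1 - θ) ^ 2 * (f' * c + f * (-s * u')) ^ 2 ≤ (f' * c + f * (-s * u')) ^ 2 := by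
    have : (1 - θ) ^ 2 ≤ 1 := by nlinarith
    nlinarith [sq_nonneg (f' * c + f * (-s * u'))]
  have a3 : W / ε2 * N ≤ Dy - κ ^ 2 * N := by linarith
  have a4 : (1 - θ) * (W / ε2 * f ^ 2) + θ * (3 * κ ^ 2 * (N - f ^ 2)) ≤ Dy - κ ^ 2 * N := by
    have : W / ε2 * f ^ 2 ≤ W / ε2 * N := mul_le_mul_of_nonneg_left h2 (by positivity)
    have b1 := mul_le_mul_of_nonneg_left (this.trans a3) (by linarith : 0 ≤ 1 - θ)
    have b2 := mul_le_mul_of_nonneg_left h3 hθ0.le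
    linarith
  have a5 : (1 - θ) * q / ε2 * (f * c) ^ 2 + c0 / ε2 * (f * s) ^ 2 ≤ W / ε2 * f ^ 2 := by
    have : W / ε2 * f ^ 2 - ((1 - θ) * q / ε2 * (f * c) ^ 2 + c0 / ε2 * (f * s) ^ 2) =
      f ^ 2 / ε2 * ((W * c ^ 2 - (1 - θ) * q * c ^ 2) + (W * s ^ 2 - c0 * s ^ 2)) := by
      linear_combination (-(W / ε2 * f ^ 2)) * hcs
    have h : 0 ≤ f ^ 2 / ε2 * ((W * c ^ 2 - (1 - θ) * q * c ^ 2) + (W * s ^ 2 - c0 * s ^ 2)) :=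
      mul_nonneg (by positivity) (by linarith)
    linarith
  have a6 := mul_le_mul_of_nonneg_left a5 (by linarith : 0 ≤ 1 - θ)
  have a7 : γ / ε2 * (f * s) ^ 2 ≤ (1 - θ) * (c0 / ε2 * (f * s) ^ 2) := by
    have : γ / ε2 ≤ (1 - θ) * c0 / ε2 := by gcongr
    have := mul_le_mul_of_nonneg_right this (sq_nonneg (f * s))
    refine this.trans (le_of_eq (by ring))
  have a8 : γ / ε2 * (N - f ^ 2) ≤ 3 * θ * κ ^ 2 * (N - f ^ 2) := mul_le_mul_of_nonneg_right hγ2 hD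
  have e1 : γ / ε2 * (N - (f * c) ^ 2) = γ / ε2 * (N - f ^ 2) + γ / ε2 * (f * s) ^ 2 := by
    linear_combination (-(γ / ε2 * f ^ 2)) * hcs
  rw [e1]
  have e2 : (1 - θ) ^ 2 * (q / ε2 * (f * c) ^ 2) = (1 - θ) * ((1 - θ) * q / ε2 * (f * c) ^ 2) := by ring
  linarith

set_option maxHeartbeats 1000000 in
lemma ns_lower_int (h q u : ℝ → ℝ) (a b M ε L κ θ γ c0 C : ℝ) (hM : 0 < M) (hε : 0 < ε) (hL : L = ε * M) (hκ : κ = π / L)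
    (hpos : ∀ x ∈ Icc (-a) b, 0 < h x) (hle : ∀ x ∈ Icc (-a) b, h x ≤ M)
    (hqc : Continuous q) (hq0 : ∀ x, 0 ≤ q x)
    (hθ0 : 0 < θ) (hθ1 : θ < 1) (hc0 : 0 ≤ c0)
    (hu : ContDiff ℝ (⊤ : ℕ∞) u) (huC : ∀ x, deriv u x ^ 2 ≤ C)
    (hW1 : ∀ x ∈ Icc (-a) b, (1 - θ) * q x * cos (u x) ^ 2 ≤ 2 * π ^ 2 * (M - h x) / M ^ 3 * cos (u x) ^ 2)
    (hW2 : ∀ x ∈ Icc (-a) b, c0 * sin (u x) ^ 2 ≤ 2 * π ^ 2 * (M - h x) / M ^ 3 * sin (u x) ^ 2)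
    (hγ1 : γ ≤ (1 - θ) * c0) (hγ2 : γ / ε ^ 2 ≤ 3 * θ * κ ^ 2)
    (ψ : ℝ × ℝ → ℝ) (hψ : ContDiff ℝ (⊤ : ℕ∞) ψ) (hs : HasCompactSupport ψ)
    (ht : tsupport ψ ⊆ {p : ℝ × ℝ | p.1 ∈ Icc (-a) b ∧ 0 < p.2 ∧ p.2 < ε * h p.1})
    (f1 : ℝ → ℝ) (hf1 : f1 = fun x => (∫ y, ψ (x, y) * (√(2 / L) * sin (π / L * y))) * cos (u x)) :
    ContDiff ℝ (⊤ : ℕ∞) f1 ∧ HasCompactSupport f1 ∧ (∫ x, f1 x ^ 2) ≤ (∫ p, ψ p ^ 2) ∧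
    (1 - θ) ^ 2 * (∫ x, (deriv f1 x ^ 2 + q x / ε ^ 2 * f1 x ^ 2)) +
      γ / ε ^ 2 * ((∫ p, ψ p ^ 2) - ∫ x, f1 x ^ 2) - C * (∫ p, ψ p ^ 2)
      ≤ (∫ p, gradSq ψ p) - κ ^ 2 * ∫ p, ψ p ^ 2 := by
  set φ : ℝ → ℝ := fun y => √(2 / L) * sin (π / L * y) with hφ
  have cφ : Continuous φ := by fun_prop
  set f : ℝ → ℝ := fun x => ∫ y, ψ (x, y) * φ y with hf
  have hfs : ContDiff ℝ (⊤ : ℕ∞) f := ns_param_smooth' φ cφ ψ hψ hs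
  have hsl := ns_slice h a b M ε L κ hM hε hL hκ hpos hle ψ hψ hs ht
  have hf1s : ContDiff ℝ (⊤ : ℕ∞) f1 := by
    rw [hf1]; exact hfs.mul (contDiff_cos.comp hu)
  have fz : ∀ x, x ∉ Icc (-a) b → f x = 0 := by
    intro x hx
    have := (hsl x).2.1
    rw [(hsl x).2.2.2.2 hx] at this
    exact pow_eq_zero_iff (two_ne_zero) |>.1 (le_antisymm this (sq_nonneg _))
  have hf1c : HasCompactSupport f1 := by
    apply HasCompactSupport.of_support_subset_isCompact (isCompact_Icc (a := -a) (b := b))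
    intro x hx
    by_contra hn
    apply hx
    rw [hf1]
    change f x * _ = 0
    rw [fz x hn, zero_mul]
  have df1 : ∀ x, deriv f1 x = (∫ y, fderiv ℝ ψ (x, y) (1, 0) * φ y) * cos (u x) + f x * (-sin (u x) * deriv u x) := by
    intro x
    have h1 := ns_param_deriv ψ hψ hs φ cφ x
    have h2 : HasDerivAt u (deriv u x) x := (hu.differentiable (by simp) x).hasDerivAt
    rw [hf1]
    exact (h1.mul h2.cos).deriv
  have iN : Integrable (fun p => ψ p ^ 2) := by
    have := ns_sq_int volume ψ ψ hψ.continuous hψ.continuous hs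
    simpa only [sq] using this
  have iv : ∀ v, Integrable (fun p => (fderiv ℝ ψ p v) ^ 2) := fun v => by
    have := ns_sq_int volume _ _ (ns_fd_smooth ψ hψ v).continuous (ns_fd_smooth ψ hψ v).continuous (ns_fd_cs ψ hs v)
    simpa only [sq] using this
  obtain ⟨N1, N2⟩ := ns_fubini _ iN
  obtain ⟨X1, X2⟩ := ns_fubini _ (iv (1, 0))
  obtain ⟨Y1, Y2⟩ := ns_fubini _ (iv (0, 1))
  have hE : (∫ p, gradSq ψ p) = (∫ x, ∫ y, (fderiv ℝ ψ (x, y) (1, 0)) ^ 2) + ∫ x, ∫ y, (fderiv ℝ ψ (x, y) (0, 1)) ^ 2 := by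
    rw [← X1, ← Y1, ← integral_add (iv _) (iv _)]
    congr 1; ext p; exact ns_gradSq_eq ψ hψ p
  have if1 : Integrable (fun x => f1 x ^ 2) := by
    have := ns_sq_int volume f1 f1 hf1s.continuous hf1s.continuous hf1c
    simpa only [sq] using this
  have cd : Continuous (deriv f1) := hf1s.continuous_deriv (by simp)
  have id1 : Integrable (fun x => deriv f1 x ^ 2) := by
    have := ns_sq_int volume _ _ cd cd hf1c.deriv
    simpa only [sq] using this
  have iq : Integrable (fun x => q x / ε ^ 2 * f1 x ^ 2) := by
    have := ns_sq_int volume f1 (fun x => q x / ε ^ 2 * f1 x) hf1s.continuous (by have := hf1s.continuous; fun_prop) hf1c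
    convert this using 2; ring
  have hfc : ∀ x, f1 x = f x * cos (u x) := fun x => by rw [hf1]
  refine ⟨hf1s, hf1c, ?_, ?_⟩
  · rw [N1]
    apply integral_mono if1 N2
    intro x
    simp only
    refine le_trans ?_ (hsl x).2.1
    change _ ≤ f x ^ 2
    rw [hfc, mul_pow]
    have := cos_sq_le_one (u x)
    nlinarith [sq_nonneg (f x)]
  · rw [hE, N1]
    have J1 : Integrable (fun x => (1 - θ) ^ 2 * (deriv f1 x ^ 2 + q x / ε ^ 2 * f1 x ^ 2)) := (id1.add iq).const_mul _
    have J2 : Integrable (fun x => γ / ε ^ 2 * ((∫ y, ψ (x, y) ^ 2) - f1 x ^ 2)) := (N2.sub if1).const_mul _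
    have J3 : Integrable (fun x => C * ∫ y, ψ (x, y) ^ 2) := N2.const_mul _
    have J4 : Integrable (fun x => κ ^ 2 * ∫ y, ψ (x, y) ^ 2) := N2.const_mul _
    have J5 : Integrable (fun x => (∫ y, (fderiv ℝ ψ (x, y) (1, 0)) ^ 2) + ∫ y, (fderiv ℝ ψ (x, y) (0, 1)) ^ 2) := X2.add Y2
    have J6 : Integrable (fun x => (1 - θ) ^ 2 * (deriv f1 x ^ 2 + q x / ε ^ 2 * f1 x ^ 2) +
      γ / ε ^ 2 * ((∫ y, ψ (x, y) ^ 2) - f1 x ^ 2)) := J1.add J2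
    rw [← integral_const_mul, ← integral_sub N2 if1, ← integral_const_mul (γ / ε ^ 2), ← integral_const_mul C,
      ← integral_const_mul (κ ^ 2), ← integral_add X2 Y2, ← integral_add J1 J2, ← integral_sub J6 J3,
      ← integral_sub J5 J4]
    apply integral_mono (J6.sub J3) (J5.sub J4)
    intro x
    simp only [Pi.sub_apply]
    obtain ⟨s1, s2, s3, s4, s5⟩ := hsl x
    rw [df1, hfc]
    by_cases hx : x ∈ Icc (-a) b
    · have hw := ns_W (h x) M ε hM hε (hpos x hx) (hle x hx)
      have hMh : 0 ≤ M - h x := by linarith [hle x hx]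
      refine ns_pt θ γ c0 C (ε ^ 2) κ (2 * π ^ 2 * (M - h x) / M ^ 3) (q x) _ _ _ _ _ _ _ _ 0 hθ0 hθ1 (by positivity)
        (sin_sq_add_cos_sq _) (huC x) s1 s2 s3 ?_ (hq0 x) (by positivity) (hW1 x hx) (hW2 x hx) hγ1 hγ2
      refine le_trans ?_ (s4 hx)
      apply mul_le_mul_of_nonneg_right _ (integral_nonneg fun y => sq_nonneg _)
      rw [hκ, hL]; linarith
    · refine ns_pt θ γ c0 C (ε ^ 2) κ (q x + c0) (q x) _ _ _ _ _ _ _ _ 0 hθ0 hθ1 (by positivity)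
        (sin_sq_add_cos_sq _) (huC x) s1 s2 s3 ?_ (hq0 x) (by linarith [hq0 x]) ?_ ?_ hγ1 hγ2
      · rw [s5 hx, mul_zero]; exact integral_nonneg fun y => sq_nonneg _
      · apply mul_le_mul_of_nonneg_right _ (sq_nonneg _)
        nlinarith [hq0 x]
      · apply mul_le_mul_of_nonneg_right _ (sq_nonneg _)
        linarith [hq0 x]

lemma ns_scale (f q : ℝ → ℝ) (ρ s ε m : ℝ) (hρ : 0 < ρ) (hs : 0 < s) (hsm : s = ρ ^ m) (hsρ : s * ρ ^ 2 = ε ^ 2)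
    (hqs : ∀ ρ t, 0 < ρ → q (ρ * t) = ρ ^ m * q t) (hf : Differentiable ℝ f) (ν : ℝ)
    (H : ν * (∫ t, (f (ρ * t)) ^ 2) ≤ ∫ t, (deriv (fun t => f (ρ * t)) t ^ 2 + q t * (f (ρ * t)) ^ 2)) :
    ν / ρ ^ 2 * (∫ x, f x ^ 2) ≤ ∫ x, (deriv f x ^ 2 + q x / ε ^ 2 * f x ^ 2) := by
  have d : ∀ t, deriv (fun t => f (ρ * t)) t = ρ * deriv f (ρ * t) := fun t => by
    have := ((hf (ρ * t)).hasDerivAt).comp t ((hasDerivAt_id t).const_mul ρ)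
    rw [mul_comm, ← mul_one ρ]
    simpa [Function.comp_def, mul_comm] using this.deriv
  have e1 : ∀ t, deriv (fun t => f (ρ * t)) t ^ 2 + q t * (f (ρ * t)) ^ 2 =
      ρ ^ 2 * (fun x => deriv f x ^ 2 + q x / ε ^ 2 * f x ^ 2) (ρ * t) := by
    intro t
    simp only
    rw [d, hqs ρ t hρ, ← hsρ, ← hsm]
    field_simp
  simp_rw [e1] at H
  rw [integral_const_mul, Measure.integral_comp_mul_left (fun x => deriv f x ^ 2 + q x / ε ^ 2 * f x ^ 2) ρ,
    Measure.integral_comp_mul_left (fun x => f x ^ 2) ρ, abs_of_pos (inv_pos.2 hρ), smul_eq_mul, smul_eq_mul] at H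
  have : ν * (ρ⁻¹ * ∫ x, f x ^ 2) = ρ⁻¹ * (ν * ∫ x, f x ^ 2) := by ring
  rw [this] at H
  have : ρ ^ 2 * (ρ⁻¹ * ∫ x, (deriv f x ^ 2 + q x / ε ^ 2 * f x ^ 2)) = ρ⁻¹ * (ρ ^ 2 * ∫ x, (deriv f x ^ 2 + q x / ε ^ 2 * f x ^ 2)) := by ring
  rw [this] at H
  have H2 := le_of_mul_le_mul_left H (inv_pos.2 hρ)
  rw [div_mul_eq_mul_div, div_le_iff₀ (by positivity)]
  linarith

lemma ns_bump (η : ℝ) (hη : 0 < η) : ∃ u : ℝ → ℝ, ∃ C : ℝ, 0 ≤ C ∧ ContDiff ℝ (⊤ : ℕ∞) u ∧ (∀ x, deriv u x ^ 2 ≤ C) ∧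
    (∀ x, |x| ≤ η / 2 → sin (u x) = 0) ∧ (∀ x, η ≤ |x| → cos (u x) = 0) := by
  let B : ContDiffBump (0:ℝ) := ⟨η / 2, η, by positivity, by linarith⟩
  have hB : ContDiff ℝ (⊤ : ℕ∞) (B : ℝ → ℝ) := B.contDiff
  have hd : Continuous (deriv (B : ℝ → ℝ)) := hB.continuous_deriv (by simp)
  obtain ⟨C, hC⟩ := hd.bounded_above_of_compact_support B.hasCompactSupport.deriv
  have hC0 : 0 ≤ C := (norm_nonneg _).trans (hC 0)
  refine ⟨fun x => π / 2 * (1 - B x), (π / 2 * C) ^ 2, by positivity, ?_, ?_, ?_, ?_⟩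
  · exact contDiff_const.mul (contDiff_const.sub hB)
  · intro x
    have h1 : HasDerivAt (B : ℝ → ℝ) (deriv B x) x := (hB.differentiable (by simp) x).hasDerivAt
    have h2 := ((h1.const_sub 1).const_mul (π / 2)).deriv
    rw [h2, mul_pow, mul_pow, neg_sq]
    have := hC x
    have h3 : deriv B x ^ 2 ≤ C ^ 2 := sq_le_sq' (abs_le.1 this).1 (abs_le.1 this).2
    gcongr
  · intro x hx
    have : B x = 1 := B.one_of_mem_closedBall (by simpa using hx)
    simp [this]
  · intro x hx
    have : B x = 0 := B.zero_of_le_dist (by simpa using hx)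
    simp [this]

set_option maxHeartbeats 1000000 in
lemma ns_lower_fin (h q : ℝ → ℝ) (a b M m K η q0 : ℝ) (hM : 0 < M) (hm : 1 ≤ m) (ha : 0 < a) (hb : 0 < b)
    (hη : 0 < η) (hqc : Continuous q) (hq0 : ∀ x, 0 ≤ q x)
    (hqs : ∀ ρ t, 0 < ρ → q (ρ * t) = ρ ^ m * q t)
    (hK : 0 < K) (hq00 : 0 < q0) (hql : ∀ x, q0 * |x| ^ m ≤ q x)
    (hcont : ContinuousOn h (Icc (-a) b))
    (hpos : ∀ x ∈ Icc (-a) b, 0 < h x) (hmax : ∀ x ∈ Icc (-a) b, x ≠ 0 → h x < M) (h0 : h 0 = M)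
    (hup : ∀ x, |x| ≤ η → h x ≤ M - M ^ 3 / (2 * π ^ 2) * q x + K * |x| ^ (m + 1))
    (j : ℕ) (hj : 1 ≤ j) (τ : ℝ) (hτ : τ < schroedingerMinMax q j) :
    ∃ r > 0, ∀ ε ρ s : ℝ, 0 < ε → 0 < ρ → ρ < r → 0 < s → s < r → s = ρ ^ m → s * ρ ^ 2 = ε ^ 2 →
      ∀ F : Submodule ℝ ((ℝ × ℝ) → ℝ), Module.finrank ℝ F = j →
      (∀ ψ ∈ F, ContDiff ℝ (⊤ : ℕ∞) ψ ∧ HasCompactSupport ψ ∧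
        tsupport ψ ⊆ {p : ℝ × ℝ | p.1 ∈ Icc (-a) b ∧ 0 < p.2 ∧ p.2 < ε * h p.1}) →
      ∃ ψ ∈ F, ψ ≠ 0 ∧ (π ^ 2 / (M ^ 2 * ε ^ 2) + τ / ρ ^ 2) * (∫ p, ψ p ^ 2) ≤ ∫ p, gradSq ψ p := by
  set μ := schroedingerMinMax q j with hμ
  have hle : ∀ x ∈ Icc (-a) b, h x ≤ M := fun x hx => by
    by_cases hx0 : x = 0
    · rw [hx0, h0]
    · exact (hmax x hx hx0).le
  obtain ⟨θ, hθτ, hθ1, hθ⟩ : ∃ θ : ℝ, τ < (1 - θ) ^ 2 * (μ - θ) ∧ θ < 1 ∧ 0 < θ := by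
    have c : Continuous (fun θ : ℝ => (1 - θ) ^ 2 * (μ - θ)) := by fun_prop
    have t : Tendsto (fun θ : ℝ => (1 - θ) ^ 2 * (μ - θ)) (nhdsWithin 0 (Ioi 0)) (nhds μ) := by
      have := (c.tendsto 0).mono_left (nhdsWithin_le_nhds (s := Ioi 0))
      simpa using this
    have e1 : ∀ᶠ θ in nhdsWithin (0:ℝ) (Ioi 0), θ < 1 := mem_nhdsWithin_of_mem_nhds (Iio_mem_nhds one_pos)
    have e2 : ∀ᶠ θ in nhdsWithin (0:ℝ) (Ioi 0), 0 < θ := self_mem_nhdsWithin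
    have e := (t.eventually_const_lt hτ).and (e1.and e2)
    exact e.exists
  set η' := min η (θ * q0 * M ^ 3 / (2 * π ^ 2 * K)) with hη'
  have hη'0 : 0 < η' := by rw [hη']; positivity
  obtain ⟨u, C, hC0, hu, huC, hu1, hu2⟩ := ns_bump η' hη'0
  obtain ⟨M', hM'1, hM'⟩ : ∃ M' < M, ∀ x ∈ Icc (-a) b, η' / 2 ≤ |x| → h x ≤ M' := by
    have hcpt : IsCompact (Icc (-a) b ∩ {x : ℝ | η' / 2 ≤ |x|}) :=
      isCompact_Icc.inter_right (isClosed_le continuous_const continuous_abs)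
    rcases (Icc (-a) b ∩ {x : ℝ | η' / 2 ≤ |x|}).eq_empty_or_nonempty with he | hne
    · refine ⟨M - 1, by linarith, fun x hx hx2 => ?_⟩
      exact absurd (show x ∈ Icc (-a) b ∩ {x : ℝ | η' / 2 ≤ |x|} from ⟨hx, hx2⟩) (by rw [he]; simp)
    · obtain ⟨x0, hx0, hx0m⟩ := hcpt.exists_isMaxOn hne (hcont.mono inter_subset_left)
      refine ⟨h x0, hmax x0 hx0.1 ?_, fun x hx hx2 => hx0m ⟨hx, hx2⟩⟩
      rintro rfl
      have := hx0.2
      simp at this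
      linarith
  set c0 := 2 * π ^ 2 * (M - M') / M ^ 3 with hc0
  have hMM : 0 < M - M' := by linarith
  have hc00 : 0 < c0 := by positivity
  have hθ' : 0 < 1 - θ := by linarith
  set γ := min ((1 - θ) * c0) (3 * θ * π ^ 2 / M ^ 2) with hγ
  have hγ0 : 0 < γ := by
    rw [hγ]; exact lt_min (by positivity) (by positivity)
  have hW1 : ∀ x ∈ Icc (-a) b, (1 - θ) * q x * cos (u x) ^ 2 ≤ 2 * π ^ 2 * (M - h x) / M ^ 3 * cos (u x) ^ 2 := by
    intro x hx
    by_cases hxη : η' ≤ |x|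
    · rw [hu2 x hxη]; simp
    push Not at hxη
    apply mul_le_mul_of_nonneg_right _ (sq_nonneg _)
    have k1 := hup x (hxη.le.trans (min_le_left _ _))
    have k2 : |x| ≤ θ * q0 * M ^ 3 / (2 * π ^ 2 * K) := hxη.le.trans (min_le_right _ _)
    have k3 : 2 * π ^ 2 / M ^ 3 * (M ^ 3 / (2 * π ^ 2) * q x - K * |x| ^ (m + 1)) ≤ 2 * π ^ 2 / M ^ 3 * (M - h x) :=
      mul_le_mul_of_nonneg_left (by linarith) (by positivity)
    have k4 : |x| ^ (m + 1) = |x| ^ m * |x| := by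
      rw [rpow_add_one' (abs_nonneg _) (by linarith)]
    have k5 : 2 * π ^ 2 / M ^ 3 * (K * |x| ^ (m + 1)) ≤ θ * q x := by
      rw [k4]
      calc 2 * π ^ 2 / M ^ 3 * (K * (|x| ^ m * |x|)) ≤ 2 * π ^ 2 / M ^ 3 * (K * (|x| ^ m * (θ * q0 * M ^ 3 / (2 * π ^ 2 * K)))) := by
            gcongr
        _ = θ * (q0 * |x| ^ m) := by field_simp
        _ ≤ _ := mul_le_mul_of_nonneg_left (hql x) hθ.le
    have k6 : 2 * π ^ 2 / M ^ 3 * (M ^ 3 / (2 * π ^ 2) * q x - K * |x| ^ (m + 1)) = q x - 2 * π ^ 2 / M ^ 3 * (K * |x| ^ (m + 1)) := by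
      field_simp
    have k7 : 2 * π ^ 2 * (M - h x) / M ^ 3 = 2 * π ^ 2 / M ^ 3 * (M - h x) := by ring
    rw [k7]
    linarith
  have hW2 : ∀ x ∈ Icc (-a) b, c0 * sin (u x) ^ 2 ≤ 2 * π ^ 2 * (M - h x) / M ^ 3 * sin (u x) ^ 2 := by
    intro x hx
    by_cases hxη : |x| ≤ η' / 2
    · rw [hu1 x hxη]; simp
    push Not at hxη
    apply mul_le_mul_of_nonneg_right _ (sq_nonneg _)
    have := hM' x hx hxη.le
    rw [hc0]
    gcongr
  set τ' := (1 - θ) ^ 2 * (μ - θ) with hτ'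
  have small : ∀ (f : ℝ → ℝ) (c : ℝ), Continuous f → f 0 = 0 → 0 < c → ∀ᶠ x in nhdsWithin (0:ℝ) (Ioi 0), f x ≤ c := by
    intro f c hf h0 hc
    have := (hf.tendsto 0).mono_left (nhdsWithin_le_nhds (s := Ioi 0))
    rw [h0] at this
    exact (this.eventually_lt_const hc).mono fun _ h => h.le
  have ev : ∀ᶠ x in nhdsWithin (0:ℝ) (Ioi 0), C * x ^ 2 ≤ τ' - τ ∧ τ' * x ≤ γ :=
    (small _ _ (by fun_prop) (by simp) (by linarith)).and (small _ _ (by fun_prop) (by simp) hγ0)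
  obtain ⟨r, hr0, hr⟩ := mem_nhdsGT_iff_exists_Ioo_subset.1 ev
  refine ⟨r, hr0, ?_⟩
  intro ε ρ s hε hρ hρr hs hsr hsm hsρ F hF1 hF2
  obtain ⟨r1, -⟩ := hr (show ρ ∈ Ioo 0 r from ⟨hρ, hρr⟩)
  obtain ⟨-, r2⟩ := hr (show s ∈ Ioo 0 r from ⟨hs, hsr⟩)
  obtain ⟨hfd, -⟩ := ns_finrank_ne F j hj hF1
  set L := ε * M with hL
  set κ := π / L with hκ
  have hγ2 : γ / ε ^ 2 ≤ 3 * θ * κ ^ 2 := by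
    have : 3 * θ * κ ^ 2 = (3 * θ * π ^ 2 / M ^ 2) / ε ^ 2 := by rw [hκ, hL]; field_simp
    rw [this]
    exact div_le_div_of_nonneg_right (min_le_right _ _) (by positivity)
  have main := fun (ψ : ℝ × ℝ → ℝ) (hψ : ψ ∈ F) => ns_lower_int h q u a b M ε L κ θ γ c0 C hM hε hL hκ hpos hle hqc hq0 hθ hθ1 hc00.le
    hu huC hW1 hW2 (min_le_left _ _) hγ2 ψ (hF2 ψ hψ).1 (hF2 ψ hψ).2.1 (hF2 ψ hψ).2.2 _ rfl
  let G : (ℝ × ℝ → ℝ) → ℝ → ℝ := fun ψ x => (∫ y, ψ (x, y) * (√(2 / L) * sin (π / L * y))) * cos (u x)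
  have isl : ∀ ψ ∈ F, ∀ x, Integrable (fun y => ψ (x, y) * (√(2 / L) * sin (π / L * y))) := by
    intro ψ hψ x
    obtain ⟨R, hR⟩ := (hF2 ψ hψ).2.1.isCompact.isBounded.subset_closedBall 0
    apply ns_sq_int volume (fun y => ψ (x, y)) _ ((hF2 ψ hψ).1.continuous.comp (by fun_prop)) (by fun_prop)
    apply HasCompactSupport.of_support_subset_isCompact (isCompact_closedBall (0:ℝ) R)
    intro y hy
    have h1 := hR (subset_tsupport ψ (show (x, y) ∈ Function.support ψ from hy))
    rw [mem_closedBall_zero_iff, Prod.norm_def] at h1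
    simpa using (le_max_right _ _).trans h1
  let T : F →ₗ[ℝ] (ℝ → ℝ) := {
    toFun := fun ψ t => G ψ.1 (ρ * t)
    map_add' := by
      intro f g; ext t
      simp only [G, Submodule.coe_add, Pi.add_apply]
      rw [← add_mul, ← integral_add (isl f.1 f.2 _) (isl g.1 g.2 _)]
      simp only [add_mul]
    map_smul' := by
      intro c f; ext t
      simp only [G, Submodule.coe_smul, Pi.smul_apply, smul_eq_mul, RingHom.id_apply]
      rw [← mul_assoc, ← integral_const_mul]
      simp only [mul_assoc] }
  have claim : ∃ ψ : F, ψ ≠ 0 ∧ (μ - θ) * (∫ t, T ψ t ^ 2) ≤ ∫ t, (deriv (T ψ) t ^ 2 + q t * T ψ t ^ 2) := by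
    by_cases hinj : Function.Injective T
    · obtain ⟨χ, ⟨ψ, hψ⟩, hχ0, hχ⟩ := ns_sch_lower q hq0 j hj θ hθ (LinearMap.range T)
        (by rw [LinearMap.finrank_range_of_inj hinj, hF1]) (by
          rintro χ ⟨ψ, rfl⟩
          obtain ⟨w1, w2, -⟩ := main ψ.1 ψ.2
          refine ⟨w1.comp (by fun_prop), ?_⟩
          exact w2.comp_homeomorph (Homeomorph.mulLeft₀ ρ hρ.ne'))
      refine ⟨ψ, ?_, ?_⟩
      · rintro rfl
        exact hχ0 (by rw [← hψ, map_zero])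
      · rw [hψ]; exact hχ
    · rw [← LinearMap.ker_eq_bot] at hinj
      obtain ⟨ψ, hψ, hψ0⟩ := (Submodule.ne_bot_iff _).1 hinj
      refine ⟨ψ, hψ0, ?_⟩
      rw [LinearMap.mem_ker.1 hψ]
      simp
  obtain ⟨ψ, hψ0, hψ⟩ := claim
  obtain ⟨w1, w2, w3, w4⟩ := main ψ.1 ψ.2
  have hsc := ns_scale (G ψ.1) q ρ s ε m hρ hs hsm hsρ hqs (w1.differentiable (by simp)) (μ - θ) hψ
  refine ⟨ψ.1, ψ.2, by simpa using hψ0, ?_⟩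
  change (∫ x, G ψ.1 x ^ 2) ≤ _ at w3
  change (1 - θ) ^ 2 * (∫ x, (deriv (G ψ.1) x ^ 2 + q x / ε ^ 2 * G ψ.1 x ^ 2)) +
      γ / ε ^ 2 * ((∫ p, ψ.1 p ^ 2) - ∫ x, G ψ.1 x ^ 2) - C * (∫ p, ψ.1 p ^ 2)
      ≤ (∫ p, gradSq ψ.1 p) - κ ^ 2 * ∫ p, ψ.1 p ^ 2 at w4
  set S := ∫ x, G ψ.1 x ^ 2
  set B := ∫ p, ψ.1 p ^ 2
  have hB0 : 0 ≤ B := integral_nonneg fun p => sq_nonneg _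
  have g1 := mul_le_mul_of_nonneg_left hsc (sq_nonneg (1 - θ))
  have g2 : (1 - θ) ^ 2 * ((μ - θ) / ρ ^ 2 * S) = τ' / ρ ^ 2 * S := by rw [hτ']; ring
  have g3 : τ' / ρ ^ 2 * (B - S) ≤ γ / ε ^ 2 * (B - S) := by
    apply mul_le_mul_of_nonneg_right _ (by linarith)
    rw [← hsρ, div_le_div_iff₀ (by positivity) (by positivity)]
    have := mul_le_mul_of_nonneg_right r2 (sq_nonneg ρ)
    linarith
  have g4 : C * B ≤ (τ' - τ) / ρ ^ 2 * B := by
    apply mul_le_mul_of_nonneg_right _ hB0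
    rw [le_div_iff₀ (by positivity)]; exact r1
  have g5 : κ ^ 2 = π ^ 2 / (M ^ 2 * ε ^ 2) := by rw [hκ, hL]; field_simp
  rw [← g5]
  have g6 : (τ' - τ) / ρ ^ 2 * B = τ' / ρ ^ 2 * S + τ' / ρ ^ 2 * (B - S) - τ / ρ ^ 2 * B := by ring
  linarith

/-- **Theorem 1.1** (Friedlander–Solomyak).  For the Dirichlet Laplacian on the thin
strip `Ω_ε = {(x,y) : x ∈ [-a,b], 0 < y < ε h(x)}`, with `h` having a unique global
maximum `M = h(0)` and the expansion `h(x) = M − c_± |x|^m + O(|x|^{m+1})` near `0`,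
the limits `μ_j = lim_{ε→0⁺} ε^{2α} (λ_j(ε) − π²/(M²ε²))` exist, where `α = 2/(m+2)`,
and `μ_j` are the eigenvalues of `H = −d²/dx² + q` on `L²(ℝ)`. -/
theorem dirichlet_laplacian_narrow_strip_two_term_asymptotics
    (a b : ℝ) (ha : 0 < a) (hb : 0 < b)
    (h : ℝ → ℝ)
    (hcont : ContinuousOn h (Icc (-a) b))
    (hpos : ∀ x ∈ Icc (-a) b, 0 < h x)
    (hmax : ∀ x ∈ Icc (-a) b, x ≠ 0 → h x < h 0)
    (hC1 : ContDiffOn ℝ 1 h (Icc (-a) b \ {0}))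
    (m cp cm K η : ℝ)
    (hm : 1 ≤ m) (hcp : 0 < cp) (hcm : 0 < cm) (hK : 0 < K) (hη : 0 < η)
    (hexp_pos : ∀ x : ℝ, 0 < x → x ≤ η →
      |h x - (h 0 - cp * x ^ m)| ≤ K * x ^ (m + 1))
    (hexp_neg : ∀ x : ℝ, -η ≤ x → x < 0 →
      |h x - (h 0 - cm * |x| ^ m)| ≤ K * |x| ^ (m + 1))
    (α : ℝ) (hα : α = 2 / (m + 2))
    (q : ℝ → ℝ)
    (hq_pos : ∀ x : ℝ, 0 < x → q x = 2 * π ^ 2 * cp * x ^ m / (h 0) ^ 3)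
    (hq_neg : ∀ x : ℝ, x ≤ 0 → q x = 2 * π ^ 2 * cm * |x| ^ m / (h 0) ^ 3)
    (j : ℕ) (hj : 1 ≤ j) :
    Tendsto
      (fun ε : ℝ =>
        ε ^ (2 * α) *
          (dirichletMinMax {p : ℝ × ℝ | p.1 ∈ Icc (-a) b ∧ 0 < p.2 ∧ p.2 < ε * h p.1} j
            - π ^ 2 / ((h 0) ^ 2 * ε ^ 2)))
      (nhdsWithin 0 (Ioi 0)) (nhds (schroedingerMinMax q j)) := by
  have hM : 0 < h 0 := hpos 0 ⟨by linarith, hb.le⟩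
  set M := h 0 with hMd
  have hm0 : 0 < m := by linarith
  have hqc : Continuous q := by
    have e : q = fun x => 2 * π ^ 2 * cp * (max x 0) ^ m / M ^ 3 + 2 * π ^ 2 * cm * (max (-x) 0) ^ m / M ^ 3 := by
      ext x
      rcases lt_or_ge 0 x with hx | hx
      · rw [hq_pos x hx, max_eq_left hx.le, max_eq_right (by linarith : -x ≤ 0), zero_rpow hm0.ne']; simp
      · rw [hq_neg x hx, max_eq_right hx, max_eq_left (by linarith : 0 ≤ -x), zero_rpow hm0.ne', abs_of_nonpos hx]; simp
    have c1 : Continuous (fun x : ℝ => (max x 0) ^ m) := (by fun_prop : Continuous fun x : ℝ => max x 0).rpow_const (fun x => Or.inr hm0.le)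
    have c2 : Continuous (fun x : ℝ => (max (-x) 0) ^ m) := (by fun_prop : Continuous fun x : ℝ => max (-x) 0).rpow_const (fun x => Or.inr hm0.le)
    rw [e]
    exact ((continuous_const.mul c1).div_const _).add ((continuous_const.mul c2).div_const _)
  have hq0 : ∀ x, 0 ≤ q x := by
    intro x
    rcases lt_or_ge 0 x with hx | hx
    · rw [hq_pos x hx]; positivity
    · rw [hq_neg x hx]; positivity
  have hqs : ∀ ρ t, 0 < ρ → q (ρ * t) = ρ ^ m * q t := by
    intro ρ t hρ
    rcases lt_or_ge 0 t with ht | ht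
    · rw [hq_pos _ (mul_pos hρ ht), hq_pos t ht, mul_rpow hρ.le ht.le]; ring
    · rw [hq_neg _ (mul_nonpos_of_nonneg_of_nonpos hρ.le ht), hq_neg t ht, abs_mul, abs_of_pos hρ, mul_rpow hρ.le (abs_nonneg _)]; ring
  set q0 := 2 * π ^ 2 * min cp cm / M ^ 3 with hq0d
  have hq00 : 0 < q0 := by
    have : 0 < min cp cm := lt_min hcp hcm
    positivity
  have hql : ∀ x, q0 * |x| ^ m ≤ q x := by
    intro x
    rcases lt_or_ge 0 x with hx | hx
    · rw [hq_pos x hx, abs_of_pos hx, hq0d, div_mul_eq_mul_div]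
      have := min_le_left cp cm
      gcongr
    · rw [hq_neg x hx, hq0d, div_mul_eq_mul_div]
      have := min_le_right cp cm
      gcongr
  have hexp : ∀ x, |x| ≤ η → |h x - (M - M ^ 3 / (2 * π ^ 2) * q x)| ≤ K * |x| ^ (m + 1) := by
    intro x hx
    have hx' := abs_le.1 hx
    rcases lt_trichotomy 0 x with h1 | h1 | h1
    · have e : M ^ 3 / (2 * π ^ 2) * q x = cp * x ^ m := by rw [hq_pos x h1]; field_simp
      rw [e, abs_of_pos h1]
      exact hexp_pos x h1 hx'.2
    · rw [← h1, hq_neg 0 le_rfl, abs_zero, zero_rpow hm0.ne', zero_rpow (by linarith)]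
      simp [hMd]
    · have e : M ^ 3 / (2 * π ^ 2) * q x = cm * |x| ^ m := by rw [hq_neg x h1.le]; field_simp
      rw [e]
      exact hexp_neg x hx'.1 h1
  have hlow : ∀ x, |x| ≤ η → M - M ^ 3 / (2 * π ^ 2) * q x - K * |x| ^ (m + 1) ≤ h x := fun x hx => by
    have := (abs_le.1 (hexp x hx)).1
    linarith
  have hup : ∀ x, |x| ≤ η → h x ≤ M - M ^ 3 / (2 * π ^ 2) * q x + K * |x| ^ (m + 1) := fun x hx => by
    have := (abs_le.1 (hexp x hx)).2
    linarith
  have hα0 : 0 < α := by rw [hα]; positivity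
  have hαm : α * (m + 2) = 2 := by rw [hα]; field_simp
  have tρ : Tendsto (fun ε : ℝ => ε ^ α) (nhdsWithin 0 (Ioi 0)) (nhds 0) := by
    have := (continuousAt_rpow_const 0 α (Or.inr hα0.le)).tendsto.mono_left (nhdsWithin_le_nhds (s := Ioi 0))
    rwa [zero_rpow hα0.ne'] at this
  have ts : Tendsto (fun ε : ℝ => (ε ^ α) ^ m) (nhdsWithin 0 (Ioi 0)) (nhds 0) := by
    have := (continuousAt_rpow_const 0 m (Or.inr hm0.le)).tendsto.comp tρ
    rwa [zero_rpow hm0.ne'] at this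
  have hε0 : ∀ᶠ ε in nhdsWithin (0:ℝ) (Ioi 0), 0 < ε := self_mem_nhdsWithin
  have facts : ∀ ε : ℝ, 0 < ε → 0 < ε ^ α ∧ 0 < (ε ^ α) ^ m ∧ (ε ^ α) ^ m * (ε ^ α) ^ 2 = ε ^ 2 ∧ ε ^ (2 * α) = (ε ^ α) ^ 2 := by
    intro ε hε
    have h1 : 0 < ε ^ α := rpow_pos_of_pos hε _
    refine ⟨h1, rpow_pos_of_pos h1 _, ?_, ?_⟩
    · rw [← rpow_natCast (ε ^ α) 2, ← rpow_add h1, ← rpow_mul hε.le]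
      push_cast
      rw [hαm, rpow_two]
    · rw [mul_comm, rpow_mul hε.le, rpow_two]
  have low : ∀ τ' < schroedingerMinMax q j, ∀ᶠ ε in nhdsWithin (0:ℝ) (Ioi 0), τ' ≤ ε ^ (2 * α) *
          (dirichletMinMax {p : ℝ × ℝ | p.1 ∈ Icc (-a) b ∧ 0 < p.2 ∧ p.2 < ε * h p.1} j
            - π ^ 2 / (M ^ 2 * ε ^ 2)) := by
    intro τ hτ
    obtain ⟨r1, hr1, H1⟩ := ns_lower_fin h q a b M m K η q0 hM hm ha hb hη hqc hq0 hqs hK hq00 hql hcont hpos hmax rfl hup j hj τ hτ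
    obtain ⟨r2, hr2, H2⟩ := ns_upper_fin h q a b M m K η hM hm ha hb hη hqc hq0 hqs hK hlow j hj (schroedingerMinMax q j + 1) (by linarith)
    filter_upwards [hε0, tρ.eventually_lt_const hr1, ts.eventually_lt_const hr1, tρ.eventually_lt_const hr2, ts.eventually_lt_const hr2]
      with ε hε a1 a2 a3 a4
    obtain ⟨b1, b2, b3, b4⟩ := facts ε hε
    obtain ⟨F, hF1, hF2, -⟩ := H2 ε (ε ^ α) ((ε ^ α) ^ m) hε b1 a3 b2 a4 rfl b3
    have := ns_dir_lower _ j hj _ ⟨F, hF1, hF2⟩ (H1 ε (ε ^ α) ((ε ^ α) ^ m) hε b1 a1 b2 a2 rfl b3)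
    rw [b4, mul_comm, ← div_le_iff₀ (by positivity)]
    linarith
  have upp : ∀ τ' > schroedingerMinMax q j, ∀ᶠ ε in nhdsWithin (0:ℝ) (Ioi 0), ε ^ (2 * α) *
          (dirichletMinMax {p : ℝ × ℝ | p.1 ∈ Icc (-a) b ∧ 0 < p.2 ∧ p.2 < ε * h p.1} j
            - π ^ 2 / (M ^ 2 * ε ^ 2)) ≤ τ' := by
    intro τ hτ
    obtain ⟨r2, hr2, H2⟩ := ns_upper_fin h q a b M m K η hM hm ha hb hη hqc hq0 hqs hK hlow j hj τ hτ
    filter_upwards [hε0, tρ.eventually_lt_const hr2, ts.eventually_lt_const hr2] with ε hε a3 a4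
    obtain ⟨b1, b2, b3, b4⟩ := facts ε hε
    obtain ⟨F, hF1, hF2, hF3⟩ := H2 ε (ε ^ α) ((ε ^ α) ^ m) hε b1 a3 b2 a4 rfl b3
    have := ns_dir_upper _ j hj _ F hF1 hF2 hF3
    rw [b4, mul_comm, ← le_div_iff₀ (by positivity)]
    linarith
  refine tendsto_order.2 ⟨fun τ hτ => ?_, fun τ hτ => ?_⟩
  · obtain ⟨τ', h1, h2⟩ := exists_between hτ
    exact (low τ' h2).mono fun ε h => h1.trans_le h
  · obtain ⟨τ', h1, h2⟩ := exists_between hτ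
    exact (upp τ' h1).mono fun ε h => h.trans_lt h2
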